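/- arXiv:1703.05378 — 5 statements merged into one kernel-verified Lean document; each statement's English description precedes it below -/
import Mathlib

section
/- Let S be a finite set of points in the plane in convex position and let ℓ be a vertical line disjoint from S that partitions S into two nonempty sets U and V. Then every non-crossing polygonal chain whose vertices are points of S, whose vertices alternate between U and V, and whose consecutive edges have strictly increasing slopes has at most three vertices. Concretely: if p, q, r, s are four points of S with p, r in one of the parts and q, s in the other, and slope(pq) < slope(qr) < slope(rs), then the segments pq and rs intersect, so the chain p,q,r,s is not non-crossing. -/
/-- Points of the plane. -/
abbrev Pt : Type := ℝ × ℝ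

/-- A set of points is in convex position if every point is a vertex of the convex hull. -/
def ConvexPosition (P : Set Pt) : Prop :=
  ∀ p ∈ P, p ∉ convexHull ℝ (P \ {p})

/-- A set of points is in general position if no three of its points are collinear. -/
def GeneralPosition (P : Set Pt) : Prop :=
  ∀ p ∈ P, ∀ q ∈ P, ∀ r ∈ P, p ≠ q → q ≠ r → p ≠ r →
    ¬ Collinear ℝ ({p, q, r} : Set Pt)

/-- Two closed segments `[a,b]` and `[c,d]` intersect in at most a common endpoint. -/
def NoCross (a b c d : Pt) : Prop :=
  ∀ x ∈ segment ℝ a b, x ∈ segment ℝ c d → ((x = a ∨ x = b) ∧ (x = c ∨ x = d))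

/-- `φ` is an edge-ordering of the complete geometric graph on `P`:
a symmetric real labelling of pairs of points, injective on unordered pairs of
distinct points of `P`. -/
def EdgeOrderOn (P : Finset Pt) (φ : Pt → Pt → ℝ) : Prop :=
  (∀ p q : Pt, φ p q = φ q p) ∧
  ∀ p ∈ P, ∀ q ∈ P, ∀ r ∈ P, ∀ s ∈ P, p ≠ q → r ≠ s →
    φ p q = φ r s → ({p, q} : Set Pt) = {r, s}

/-- A non-crossing path of length `k` (that is, with `k` edges) in the
complete geometric graph on `P`: a sequence of `k+1` distinct points of `P`
any two of whose edges intersect in at most a common endpoint. -/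
def IsNCPath (P : Finset Pt) (k : ℕ) (v : Fin (k + 1) → Pt) : Prop :=
  (∀ i, v i ∈ P) ∧ Function.Injective v ∧
  ∀ i j : Fin k, i ≠ j →
    NoCross (v i.castSucc) (v i.succ) (v j.castSucc) (v j.succ)

/-- The edge labels along the path are strictly increasing or strictly decreasing. -/
def PathMonotone (φ : Pt → Pt → ℝ) (k : ℕ) (v : Fin (k + 1) → Pt) : Prop :=
  StrictMono (fun i : Fin k => φ (v i.castSucc) (v i.succ)) ∨
  StrictAnti (fun i : Fin k => φ (v i.castSucc) (v i.succ))

/-- The number of vertices of a complete binary tree of height `h`. -/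
def treeSize (h : ℕ) : ℕ := 2 ^ (h + 1) - 1

/-- Parent of a vertex in the heap indexing of a complete binary tree:
the root is `0` and the children of `i` are `2*i+1` and `2*i+2`. -/
def par (j : ℕ) : ℕ := (j - 1) / 2

/-- An embedding of the complete binary tree of height `h` (in heap indexing) into
the point set `P`: an assignment of the `2^(h+1) - 1` tree vertices to distinct
points of `P`. -/
def TreeEmbed (P : Finset Pt) (h : ℕ) (t : ℕ → Pt) : Prop :=
  (∀ i < treeSize h, t i ∈ P) ∧
  ∀ i < treeSize h, ∀ j < treeSize h, t i = t j → i = j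

/-- The embedded complete binary tree of height `h` is non-crossing: any two of
its (drawn) edges intersect in at most a common endpoint.  The edge leading to a
non-root vertex `i` is the segment from `t (par i)` to `t i`. -/
def TreeNonCross (h : ℕ) (t : ℕ → Pt) : Prop :=
  ∀ i, 1 ≤ i → i < treeSize h → ∀ j, 1 ≤ j → j < treeSize h → i ≠ j →
    NoCross (t (par i)) (t i) (t (par j)) (t j)

/-- The embedded tree is increasing: along every root-to-leaf path the labels are
strictly increasing.  Equivalently (in a complete binary tree), for every vertex `j`
at depth at least two, the label of the edge above its parent is smaller than the
label of the edge above `j`. -/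
def TreeIncreasing (φ : Pt → Pt → ℝ) (h : ℕ) (t : ℕ → Pt) : Prop :=
  ∀ j, 3 ≤ j → j < treeSize h →
    φ (t (par (par j))) (t (par j)) < φ (t (par j)) (t j)

/-- The embedded tree is decreasing: along every root-to-leaf path the labels are
strictly decreasing. -/
def TreeDecreasing (φ : Pt → Pt → ℝ) (h : ℕ) (t : ℕ → Pt) : Prop :=
  ∀ j, 3 ≤ j → j < treeSize h →
    φ (t (par j)) (t j) < φ (t (par (par j))) (t (par j))

/-- The embedded tree is monotone: it is increasing or decreasing. -/
def TreeMonotone (φ : Pt → Pt → ℝ) (h : ℕ) (t : ℕ → Pt) : Prop :=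
  TreeIncreasing φ h t ∨ TreeDecreasing φ h t

/-- The slope of the segment from `p` to `q`. -/
noncomputable def mySlope (p q : Pt) : ℝ := (q.2 - p.2) / (q.1 - p.1)

lemma hull3 (S : Set Pt) (hconv : ConvexPosition S) (p x y z : Pt) (hp : p ∈ S)
    (hx : x ∈ S) (hy : y ∈ S) (hz : z ∈ S) (hxp : x ≠ p) (hyp : y ≠ p) (hzp : z ≠ p)
    (A B C D : ℝ) (hA : 0 < A) (hB : 0 ≤ B) (hC : 0 ≤ C) (hD : 0 ≤ D) (hsum : A = B + C + D)
    (e1 : A * p.1 = B * x.1 + C * y.1 + D * z.1)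
    (e2 : A * p.2 = B * x.2 + C * y.2 + D * z.2) : False := by
  apply hconv p hp
  have hm : ∀ w ∈ S, w ≠ p → w ∈ convexHull ℝ (S \ {p}) := fun w hw hne =>
    subset_convexHull ℝ _ ⟨hw, hne⟩
  have key := (convex_convexHull ℝ (S \ {p})).sum_mem (t := Finset.univ)
    (w := ![B / A, C / A, D / A]) (z := ![x, y, z])
    (by intro i _; fin_cases i <;> simp <;> positivity)
    (by simp [Fin.sum_univ_three]; field_simp; linarith)
    (by intro i _; fin_cases i
        · exact hm x hx hxp
        · exact hm y hy hyp
        · exact hm z hz hzp)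
  convert key using 1
  simp only [Fin.sum_univ_three]
  ext
  · simp; field_simp; linarith
  · simp; field_simp; linarith

lemma core (S : Set Pt) (hconv : ConvexPosition S) (a : ℝ)
    (p q r s : Pt) (hp : p ∈ S) (hq : q ∈ S) (hr : r ∈ S) (hs : s ∈ S)
    (hpq : p ≠ q) (hpr : p ≠ r) (hps : p ≠ s)
    (hqr : q ≠ r) (hqs : q ≠ s) (hrs : r ≠ s)
    (hside : (p.1 < a ∧ r.1 < a ∧ a < q.1 ∧ a < s.1) ∨
             (a < p.1 ∧ a < r.1 ∧ q.1 < a ∧ s.1 < a))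
    (A B C D : ℝ) (hA : 0 < A) (hB : 0 < B) (hsum : A + C = B + D)
    (e1 : A * p.1 + C * q.1 = B * s.1 + D * r.1)
    (e2 : A * p.2 + C * q.2 = B * s.2 + D * r.2) :
    (segment ℝ p q ∩ segment ℝ r s).Nonempty ∧ ¬ NoCross p q r s := by
  have hne : (segment ℝ p q ∩ segment ℝ r s).Nonempty := by
    rcases le_or_gt C 0 with hC | hC
    · rcases le_or_gt 0 D with hD | hD
      · exact (hull3 S hconv p s r q hp hs hr hq hps.symm hpr.symm hpq.symm A B D (-C) hA hB.le hD
          (by linarith) (by linarith) (by linarith) (by linarith)).elim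
      · exfalso
        rcases hside with ⟨h1, h2, h3, h4⟩ | ⟨h1, h2, h3, h4⟩
        · have h0 : a * (A + C) = a * (B + D) := by rw [hsum]
          nlinarith [mul_pos hA (sub_pos.2 h1), mul_pos (neg_pos.2 hD) (sub_pos.2 h2),
            mul_pos hB (sub_pos.2 h4), mul_nonneg (neg_nonneg.2 hC) (sub_pos.2 h3).le]
        · have h0 : a * (A + C) = a * (B + D) := by rw [hsum]
          nlinarith [mul_pos hA (sub_pos.2 h1), mul_pos (neg_pos.2 hD) (sub_pos.2 h2),
            mul_pos hB (sub_pos.2 h4), mul_nonneg (neg_nonneg.2 hC) (sub_pos.2 h3).le]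
    · rcases le_or_gt D 0 with hD | hD
      · exact (hull3 S hconv s p q r hs hp hq hr hps hqs hrs B A C (-D) hB hA.le hC.le
          (by linarith) (by linarith) (by linarith) (by linarith)).elim
      · have hpos : 0 < A + C := by linarith
        have hpos' : 0 < B + D := by linarith
        refine ⟨(A / (A + C)) • p + (C / (A + C)) • q,
          ⟨_, _, by positivity, by positivity, by field_simp, rfl⟩,
          ⟨D / (B + D), B / (B + D), by positivity, by positivity, by field_simp; ring, ?_⟩⟩
        rw [hsum]
        ext
        · simp; field_simp; linarith
        · simp; field_simp; linarith
  refine ⟨hne, fun h => ?_⟩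
  obtain ⟨x, hx, hy⟩ := hne
  obtain ⟨h | h, h' | h'⟩ := h x hx hy
  · exact hpr (h.symm.trans h')
  · exact hps (h.symm.trans h')
  · exact hqr (h.symm.trans h')
  · exact hqs (h.symm.trans h')


/-- If a vertical line `x = a` splits a finite convex-position set `S`
into two nonempty parts, and `p, q, r, s` are four distinct points of `S` alternating
between the two sides with strictly increasing slopes along the chain `p q r s`,
then the segments `pq` and `rs` intersect; in particular the chain is not
non-crossing. -/
theorem stmt0 (S : Set Pt) (hfin : S.Finite) (hconv : ConvexPosition S)
    (a : ℝ) (hline : ∀ p ∈ S, p.1 ≠ a)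
    (hU : ∃ p ∈ S, p.1 < a) (hV : ∃ p ∈ S, a < p.1)
    (p q r s : Pt) (hp : p ∈ S) (hq : q ∈ S) (hr : r ∈ S) (hs : s ∈ S)
    (hpq : p ≠ q) (hpr : p ≠ r) (hps : p ≠ s)
    (hqr : q ≠ r) (hqs : q ≠ s) (hrs : r ≠ s)
    (hside : (p.1 < a ∧ r.1 < a ∧ a < q.1 ∧ a < s.1) ∨
             (a < p.1 ∧ a < r.1 ∧ q.1 < a ∧ s.1 < a))
    (h1 : mySlope p q < mySlope q r) (h2 : mySlope q r < mySlope r s) :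
    (segment ℝ p q ∩ segment ℝ r s).Nonempty ∧ ¬ NoCross p q r s := by
  refine core S hconv a p q r s hp hq hr hs hpq hpr hps hqr hqs hrs hside
    (-((r.1 - q.1) * (s.2 - q.2) - (r.2 - q.2) * (s.1 - q.1)))
    (-((q.1 - p.1) * (r.2 - p.2) - (q.2 - p.2) * (r.1 - p.1)))
    ((r.1 - p.1) * (s.2 - p.2) - (r.2 - p.2) * (s.1 - p.1))
    ((q.1 - p.1) * (s.2 - p.2) - (q.2 - p.2) * (s.1 - p.1)) ?_ ?_ (by ring) (by ring) (by ring)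
  · unfold mySlope at h2
    rcases hside with ⟨k1, k2, k3, k4⟩ | ⟨k1, k2, k3, k4⟩
    · rw [← neg_div_neg_eq, div_lt_div_iff₀ (by linarith) (by linarith)] at h2
      nlinarith
    · rw [← neg_div_neg_eq (s.2 - r.2), div_lt_div_iff₀ (by linarith) (by linarith)] at h2
      nlinarith
  · unfold mySlope at h1
    rcases hside with ⟨k1, k2, k3, k4⟩ | ⟨k1, k2, k3, k4⟩
    · rw [← neg_div_neg_eq (r.2 - q.2), div_lt_div_iff₀ (by linarith) (by linarith)] at h1
      nlinarith
    · rw [← neg_div_neg_eq, div_lt_div_iff₀ (by linarith) (by linarith)] at h1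
      nlinarith
end

section
/- There is a constant c > 0 such that for every n ≥ 3 and every injective function f from the 2-element subsets of {1,…,n} to ℝ, there exist indices i_1 < i_2 < … < i_m with m ≥ c·log log n such that either f({i_a,i_b}) < f({i_b,i_c}) for all a < b < c, or f({i_a,i_b}) > f({i_b,i_c}) for all a < b < c. In particular, the labels along the path i_1, i_2, …, i_m are strictly monotone. -/
theorem aux_er {α : Type*} [LinearOrder α] (χ : α → α → α → Prop) (k : ℕ) :
    ∀ S T : Finset α, (∀ a ∈ S, ∀ b ∈ T, a < b) → 2 ^ (k * (S.card + k)) ≤ T.card →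
      ∃ U ⊆ T, U.card = k ∧ ∀ a ∈ S ∪ U, ∀ b ∈ U, ∀ c ∈ U, ∀ d ∈ U,
        a < b → b < c → b < d → (χ a b c ↔ χ a b d) := by
  classical
  induction k with
  | zero =>
    intro S T _ _
    exact ⟨∅, by simp, by simp, by simp⟩
  | succ k ih =>
    intro S T hST hT
    have hne : T.Nonempty := by
      rw [← Finset.card_pos]
      exact lt_of_lt_of_le (by positivity) hT
    set t := T.min' hne with ht
    have htT : t ∈ T := T.min'_mem hne
    have hlt : ∀ x ∈ T.erase t, t < x := by
      intro x hx
      exact T.min'_lt_of_mem_erase_min' hne hx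
    have hcard : (T.erase t).card + 1 = T.card := Finset.card_erase_add_one htT
    have hS : t ∉ S := fun h => lt_irrefl _ (hST t h t htT)
    have hpow : 2 ^ S.card * 2 ^ (k * (S.card + 1 + k)) * 2 ≤ 2 ^ ((k + 1) * (S.card + (k + 1))) := by
      rw [← pow_add, ← pow_succ]
      apply Nat.pow_le_pow_right (by norm_num)
      nlinarith
    have hpos : 0 < 2 ^ S.card * 2 ^ (k * (S.card + 1 + k)) := by positivity
    have hpos2 : 0 < 2 ^ (k * (S.card + 1 + k)) := by positivity
    have hpos3 : 0 < 2 ^ S.card := by positivity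
    have hpg : S.powerset.card * (2 ^ (k * (S.card + 1 + k)) - 1) < (T.erase t).card := by
      rw [Finset.card_powerset, Nat.mul_sub]
      omega
    obtain ⟨y, -, hy⟩ := Finset.exists_lt_card_fiber_of_mul_lt_card_of_maps_to
      (s := T.erase t) (t := S.powerset) (f := fun c => S.filter (fun a => χ a t c))
      (by intro c _; simp) hpg
    obtain ⟨U, hUT, hUc, hU⟩ := ih (insert t S)
      ((T.erase t).filter (fun c => S.filter (fun a => χ a t c) = y))
      (by
        intro a ha b hb
        have hb' := (Finset.mem_filter.1 hb).1
        rcases Finset.mem_insert.1 ha with rfl | ha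
        · exact hlt b hb'
        · exact hST a ha b (Finset.mem_of_mem_erase hb'))
      (by
        rw [Finset.card_insert_of_notMem hS]
        omega)
    have hUT' : ∀ x ∈ U, x ∈ T.erase t := fun x hx => (Finset.mem_filter.1 (hUT hx)).1
    have htU : t ∉ U := fun h => by simpa using hUT' t h
    refine ⟨insert t U, ?_, ?_, ?_⟩
    · intro x hx
      rcases Finset.mem_insert.1 hx with rfl | hx
      · exact htT
      · exact Finset.mem_of_mem_erase (hUT' x hx)
    · rw [Finset.card_insert_of_notMem htU, hUc]
    · intro a ha b hb c hc d hd hab hbc hbd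
      have key : ∀ x ∈ insert t U, t ≤ x := by
        intro x hx
        rcases Finset.mem_insert.1 hx with rfl | hx
        · exact le_rfl
        · exact (hlt x (hUT' x hx)).le
      have mem : ∀ x ∈ insert t U, b < x → x ∈ U := by
        intro x hx hbx
        rcases Finset.mem_insert.1 hx with rfl | hx
        · exact absurd hbx (not_lt.2 (key b hb))
        · exact hx
      have hc' := mem c hc hbc
      have hd' := mem d hd hbd
      rcases Finset.mem_insert.1 hb with hbt | hbU
      · rw [hbt] at hab ⊢
        have haS : a ∈ S := by
          rcases Finset.mem_union.1 ha with h | h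
          · exact h
          · exact absurd hab (not_lt.2 (key a h))
        have h1 := (Finset.mem_filter.1 (hUT hc')).2
        have h2 := (Finset.mem_filter.1 (hUT hd')).2
        have h3 : a ∈ S.filter (fun a => χ a t c) ↔ a ∈ S.filter (fun a => χ a t d) := by
          rw [h1, h2]
        simpa [haS] using h3
      · refine hU a ?_ b hbU c hc' d hd' hab hbc hbd
        simp only [Finset.mem_union, Finset.mem_insert] at ha ⊢
        tauto

theorem aux_ramsey {α : Type*} [LinearOrder α] (ψ : α → α → Prop) (k : ℕ) :
    ∀ p q : ℕ, p + q = k → ∀ U : Finset α, 2 ^ k ≤ U.card →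
      (∃ V ⊆ U, V.card = p ∧ ∀ a ∈ V, ∀ b ∈ V, a < b → ψ a b) ∨
      (∃ V ⊆ U, V.card = q ∧ ∀ a ∈ V, ∀ b ∈ V, a < b → ¬ ψ a b) := by
  classical
  induction k with
  | zero =>
    intro p q hpq U _
    exact Or.inl ⟨∅, by simp, by simp; omega, by simp⟩
  | succ k ih =>
    intro p q hpq U hU
    rcases Nat.eq_zero_or_pos p with hp | hp
    · exact Or.inl ⟨∅, by simp, by simp [hp], by simp⟩
    rcases Nat.eq_zero_or_pos q with hq | hq
    · exact Or.inr ⟨∅, by simp, by simp [hq], by simp⟩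
    have hne : U.Nonempty := by
      rw [← Finset.card_pos]
      exact lt_of_lt_of_le (by positivity) hU
    set t := U.min' hne with ht
    have htU : t ∈ U := U.min'_mem hne
    have hlt : ∀ x ∈ U.erase t, t < x := by
      intro x hx
      exact U.min'_lt_of_mem_erase_min' hne hx
    have hcard : (U.erase t).card + 1 = U.card := Finset.card_erase_add_one htU
    have hsplit := Finset.card_filter_add_card_filter_not (s := U.erase t) (fun x => ψ t x)
    have ext : ∀ (θ : α → α → Prop) (V : Finset α) (r : ℕ),
        V ⊆ (U.erase t).filter (fun x => θ t x) → V.card = r →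
        (∀ a ∈ V, ∀ b ∈ V, a < b → θ a b) →
        ∃ W ⊆ U, W.card = r + 1 ∧ ∀ a ∈ W, ∀ b ∈ W, a < b → θ a b := by
      intro θ V r hV hr hθ
      have hV1 : ∀ x ∈ V, x ∈ U.erase t := fun x hx => (Finset.mem_filter.1 (hV hx)).1
      have hV2 : ∀ x ∈ V, θ t x := fun x hx => (Finset.mem_filter.1 (hV hx)).2
      have htV : t ∉ V := fun h => by simpa using hV1 t h
      refine ⟨insert t V, ?_, by rw [Finset.card_insert_of_notMem htV, hr], ?_⟩
      · intro x hx
        rcases Finset.mem_insert.1 hx with rfl | hx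
        · exact htU
        · exact Finset.mem_of_mem_erase (hV1 x hx)
      · intro a ha b hb hab
        rcases Finset.mem_insert.1 ha with hat | ha
        · rcases Finset.mem_insert.1 hb with hbt | hb
          · rw [hat, hbt] at hab
            exact absurd hab (lt_irrefl _)
          · rw [hat]
            exact hV2 b hb
        · rcases Finset.mem_insert.1 hb with hbt | hb
          · rw [hbt] at hab
            exact absurd hab (not_lt.2 (hlt a (hV1 a ha)).le)
          · exact hθ a ha b hb hab
    have hsub : ∀ (P : α → Prop), (U.erase t).filter P ⊆ U := fun P x hx =>
      Finset.mem_of_mem_erase (Finset.mem_filter.1 hx).1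
    rw [pow_succ] at hU
    by_cases h : 2 ^ k ≤ ((U.erase t).filter (fun x => ψ t x)).card
    · rcases ih (p - 1) q (by omega) _ h with ⟨V, hV, hc, hψ⟩ | ⟨V, hV, hc, hψ⟩
      · left
        have := ext ψ V (p - 1) hV hc hψ
        rwa [Nat.sub_add_cancel hp] at this
      · exact Or.inr ⟨V, hV.trans (hsub _), hc, hψ⟩
    · have h' : 2 ^ k ≤ ((U.erase t).filter (fun x => ¬ ψ t x)).card := by omega
      rcases ih p (q - 1) (by omega) _ h' with ⟨V, hV, hc, hψ⟩ | ⟨V, hV, hc, hψ⟩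
      · exact Or.inl ⟨V, fun x hx => Finset.mem_of_mem_erase (Finset.mem_filter.1 (hV hx)).1, hc, hψ⟩
      · right
        have := ext (fun a b => ¬ ψ a b) V (q - 1) (by convert hV) hc hψ
        rwa [Nat.sub_add_cancel hq] at this

theorem aux_three {α : Type*} [LinearOrder α] (χ : α → α → α → Prop) (m : ℕ)
    (T : Finset α) (hT : 2 ^ (2 ^ (4 * m)) ≤ T.card) :
    ∃ V : Finset α, V.card = m ∧
      ((∀ a ∈ V, ∀ b ∈ V, ∀ c ∈ V, a < b → b < c → χ a b c) ∨
       (∀ a ∈ V, ∀ b ∈ V, ∀ c ∈ V, a < b → b < c → ¬ χ a b c)) := by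
  obtain ⟨U, -, hUc, hU⟩ := aux_er χ (2 ^ (m + m)) ∅ T (by simp) (by
    rw [Finset.card_empty, zero_add, ← pow_add]
    have : m + m + (m + m) = 4 * m := by ring
    rwa [this])
  rcases aux_ramsey (fun a b => ∃ c ∈ U, b < c ∧ χ a b c) (m + m) m m rfl U hUc.ge with
    ⟨V, hV, hc, hψ⟩ | ⟨V, hV, hc, hψ⟩
  · refine ⟨V, hc, Or.inl ?_⟩
    intro a ha b hb c hc hab hbc
    obtain ⟨d, hd, hbd, h⟩ := hψ a ha b hb hab
    exact (hU a (by simpa using hV ha) b (hV hb) c (hV hc) d hd hab hbc hbd).2 h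
  · refine ⟨V, hc, Or.inr ?_⟩
    intro a ha b hb c hc hab hbc h
    exact hψ a ha b hb hab ⟨c, hV hc, hbc, h⟩

theorem aux_log (n : ℕ) (hn : 3 ≤ n) :
    Real.log (Real.log n) ≤ 4 * ((Nat.log 2 (Nat.log 2 n) / 4 : ℕ) : ℝ) + 4 := by
  set L := Nat.log 2 n with hL
  set l := Nat.log 2 L with hl
  have h1 : n < 2 ^ (L + 1) := Nat.lt_pow_succ_log_self (by norm_num) n
  have h2 : L < 2 ^ (l + 1) := Nat.lt_pow_succ_log_self (by norm_num) L
  have hl2 : Real.log 2 ≤ 1 := by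
    have := Real.log_two_lt_d9
    linarith
  have hlogpow : ∀ (x k : ℕ), 0 < x → x ≤ 2 ^ k → Real.log x ≤ k := by
    intro x k hx hxk
    have : Real.log x ≤ Real.log ((2 : ℝ) ^ k) :=
      Real.log_le_log (by exact_mod_cast hx) (by exact_mod_cast hxk)
    rw [Real.log_pow] at this
    nlinarith [(Nat.cast_nonneg k : (0 : ℝ) ≤ k)]
  have h3 : Real.log n ≤ ((L + 1 : ℕ) : ℝ) := hlogpow n (L + 1) (by omega) h1.le
  have hpos : 0 < Real.log n := Real.log_pos (by exact_mod_cast (by omega : 1 < n))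
  have h4 : Real.log (Real.log n) ≤ Real.log ((L + 1 : ℕ) : ℝ) := Real.log_le_log hpos h3
  have h5 := hlogpow (L + 1) (l + 1) (by omega) h2
  have h6 : ((l + 1 : ℕ) : ℝ) ≤ ((4 * (l / 4) + 4 : ℕ) : ℝ) := by
    exact_mod_cast (by omega)
  push_cast at *
  linarith

/-- There is a constant `c > 0` such that for every `n ≥ 3` and every
injective labelling `f` of the 2-element subsets of `{1,…,n}` by reals, there is a
strictly increasing sequence of at least `c·log log n` indices along which the labels
of consecutive pairs form a strictly monotone sequence (in the transitive, Ramsey sense). -/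
theorem stmt1 : ∃ c : ℝ, 0 < c ∧
    ∀ n : ℕ, 3 ≤ n → ∀ f : Finset (Fin n) → ℝ,
      (∀ s t : Finset (Fin n), s.card = 2 → t.card = 2 → f s = f t → s = t) →
      ∃ (m : ℕ) (v : Fin m → Fin n), StrictMono v ∧
        c * Real.log (Real.log n) ≤ (m : ℝ) ∧
        ((∀ a b c' : Fin m, a < b → b < c' → f {v a, v b} < f {v b, v c'}) ∨
         (∀ a b c' : Fin m, a < b → b < c' → f {v b, v c'} < f {v a, v b})) := by
  refine ⟨1 / 8, by norm_num, ?_⟩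
  intro n hn f hf
  have hlog := aux_log n hn
  set m := Nat.log 2 (Nat.log 2 n) / 4 with hm
  rcases Nat.eq_zero_or_pos m with h0 | hpos
  · refine ⟨1, fun _ => ⟨0, by omega⟩, ?_, ?_, Or.inl ?_⟩
    · intro a b hab
      exact absurd hab (by simp [Subsingleton.elim a b])
    · rw [h0] at hlog
      push_cast at *
      linarith
    · intro a b c hab
      exact absurd hab (by simp [Subsingleton.elim a b])
  · have hbig : 2 ^ (2 ^ (4 * m)) ≤ (Finset.univ : Finset (Fin n)).card := by
      rw [Finset.card_univ, Fintype.card_fin]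
      have hL : Nat.log 2 n ≠ 0 := by
        have : 0 < Nat.log 2 n := Nat.log_pos (by norm_num) (by omega)
        omega
      calc 2 ^ (2 ^ (4 * m)) ≤ 2 ^ (2 ^ (Nat.log 2 (Nat.log 2 n))) :=
            Nat.pow_le_pow_right (by norm_num)
              (Nat.pow_le_pow_right (by norm_num) (by omega))
        _ ≤ 2 ^ (Nat.log 2 n) :=
            Nat.pow_le_pow_right (by norm_num) (Nat.pow_log_le_self 2 hL)
        _ ≤ n := Nat.pow_log_le_self 2 (by omega)
    obtain ⟨V, hVc, hV⟩ := aux_three (fun a b c : Fin n => f {a, b} < f {b, c}) m _ hbig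
    refine ⟨m, V.orderEmbOfFin hVc, (V.orderEmbOfFin hVc).strictMono, ?_, ?_⟩
    · have : (1 : ℝ) ≤ m := by exact_mod_cast hpos
      linarith
    · have hmem := V.orderEmbOfFin_mem hVc
      have hmono := (V.orderEmbOfFin hVc).strictMono
      refine hV.imp ?_ ?_
      · intro h a b c hab hbc
        exact h _ (hmem a) _ (hmem b) _ (hmem c) (hmono hab) (hmono hbc)
      · intro h a b c hab hbc
        have hab' := hmono hab
        have hbc' := hmono hbc
        refine lt_of_le_of_ne (not_lt.1 (h _ (hmem a) _ (hmem b) _ (hmem c) hab' hbc')) ?_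
        intro heq
        have hs := hf _ _ (Finset.card_pair hbc'.ne) (Finset.card_pair hab'.ne) heq
        have ha : V.orderEmbOfFin hVc a ∈
            ({V.orderEmbOfFin hVc b, V.orderEmbOfFin hVc c} : Finset (Fin n)) := by
          rw [hs]
          simp
        rcases Finset.mem_insert.1 ha with h1 | h1
        · exact hab'.ne h1
        · exact (hab'.trans hbc').ne (Finset.mem_singleton.1 h1)
end

section
/- There is a constant c > 0 such that for every n ≥ 2, every set P of n points in the plane in general position, and every edge-ordering φ of the complete geometric graph on P, there exists a non-crossing monotone path in the complete geometric graph on P of length at least c·log log n. (Hence ᾱ(K_n) = Ω(log log n), where ᾱ(K_n) is the minimum over straight-line drawings of K_n and over edge-orderings of the maximum length of a non-crossing monotone path.) -/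
/-- Monotone chain with `k+1` edges ending in the edge `u v`, increasing lexicographically. -/
inductive Chn (P : Finset Pt) (φ : Pt → Pt → ℝ) (R : ℝ → ℝ → Prop) : ℕ → Pt → Pt → Prop
  | base (u v : Pt) : u ∈ P → v ∈ P → toLex u < toLex v → Chn P φ R 0 u v
  | step (k : ℕ) (u v w : Pt) : Chn P φ R k u v → w ∈ P → toLex v < toLex w →
      R (φ u v) (φ v w) → Chn P φ R (k + 1) v w

lemma Chn.exists_fun {P : Finset Pt} {φ : Pt → Pt → ℝ} {R : ℝ → ℝ → Prop} {k : ℕ} {u v : Pt}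
    (h : Chn P φ R k u v) : ∃ p : ℕ → Pt, (∀ i ≤ k + 1, p i ∈ P) ∧
      (∀ i ≤ k, toLex (p i) < toLex (p (i + 1))) ∧
      (∀ i < k, R (φ (p i) (p (i + 1))) (φ (p (i + 1)) (p (i + 2)))) ∧
      p k = u ∧ p (k + 1) = v := by
  induction h with
  | base u v hu hv huv =>
    refine ⟨fun i => if i = 0 then u else v, ?_, ?_, ?_, by simp, by simp⟩
    · intro i _
      dsimp only
      split_ifs <;> assumption
    · intro i hi
      obtain rfl : i = 0 := by omega
      simpa using huv
    · intro i hi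
      omega
  | step k u v w _ hw hvw hR ih =>
    obtain ⟨p, h1, h2, h3, h4, h5⟩ := ih
    refine ⟨fun i => if i ≤ k + 1 then p i else w, ?_, ?_, ?_, by simp [h5], by simp⟩
    · intro i _
      dsimp only
      split_ifs with h
      · exact h1 i h
      · exact hw
    · intro i hi
      rcases Nat.lt_or_ge i (k + 1) with h | h
      · simpa [show i ≤ k + 1 by omega, show i ≤ k by omega] using h2 i (by omega)
      · obtain rfl : i = k + 1 := by omega
        simpa [h5] using hvw
    · intro i hi
      rcases Nat.lt_or_ge i k with h | h
      · simpa [show i ≤ k + 1 by omega, show i ≤ k by omega, show i + 2 ≤ k + 1 by omega]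
          using h3 i h
      · obtain rfl : i = k := by omega
        simpa [h5, h4] using hR

lemma seg_lex {a b x : Pt} (hab : toLex a < toLex b) (hx : x ∈ segment ℝ a b) :
    toLex a ≤ toLex x ∧ toLex x ≤ toLex b := by
  obtain ⟨s, t, hs, ht, hst, rfl⟩ := hx
  obtain rfl : s = 1 - t := by linarith
  rw [Prod.Lex.toLex_lt_toLex] at hab
  simp only [Prod.Lex.toLex_le_toLex, Prod.fst_add, Prod.snd_add, Prod.smul_fst, Prod.smul_snd,
    smul_eq_mul]
  rcases hab with h | ⟨h, h'⟩
  · constructor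
    · rcases ht.eq_or_lt with rfl | ht
      · right; constructor <;> simp
      · left; nlinarith
    · rcases hs.eq_or_lt with h0 | hs
      · obtain rfl : t = 1 := by linarith
        right; constructor <;> simp
      · left; nlinarith
  · rw [h]
    constructor
    · right; constructor
      · ring
      · nlinarith
    · right; constructor
      · ring
      · nlinarith

lemma nocross_lex {a b c d : Pt} (hab : toLex a < toLex b) (hbc : toLex b ≤ toLex c)
    (hcd : toLex c < toLex d) : NoCross a b c d := by
  intro x h1 h2
  have h3 := (seg_lex hab h1).2
  have h4 := (seg_lex hcd h2).1
  have e1 : toLex x = toLex b := le_antisymm h3 (hbc.trans h4)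
  have e2 : toLex x = toLex c := le_antisymm (h3.trans hbc) h4
  exact ⟨Or.inr (toLex.injective e1), Or.inl (toLex.injective e2)⟩

lemma Chn.path {P : Finset Pt} {φ : Pt → Pt → ℝ} {R : ℝ → ℝ → Prop} {k : ℕ} {u v : Pt}
    (h : Chn P φ R k u v) : ∃ q : Fin (k + 1 + 1) → Pt, IsNCPath P (k + 1) q ∧
      ∀ i : Fin k, R (φ (q i.castSucc.castSucc) (q i.castSucc.succ))
        (φ (q i.succ.castSucc) (q i.succ.succ)) := by
  obtain ⟨p, h1, h2, h3, -, -⟩ := h.exists_fun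
  have hm : StrictMono (fun i : Fin (k + 1 + 1) => toLex (p i)) := by
    rw [Fin.strictMono_iff_lt_succ]
    intro i
    simpa using h2 i (by omega)
  refine ⟨fun i => p i, ⟨fun i => h1 i (by omega), ?_, ?_⟩, ?_⟩
  · intro i j hij
    exact hm.injective (congrArg toLex hij)
  · have key : ∀ i j : Fin (k + 1), i < j →
        NoCross (p i.castSucc) (p i.succ) (p j.castSucc) (p j.succ) := by
      intro i j hij
      refine nocross_lex (hm Fin.castSucc_lt_succ) (hm.monotone ?_)
        (hm Fin.castSucc_lt_succ)
      rw [Fin.le_def]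
      simpa using hij
    intro i j hij
    rcases lt_or_gt_of_ne hij with h | h
    · exact key i j h
    · intro x hx hx'
      exact (key j i h x hx' hx).symm
  · intro i
    simpa using h3 i i.2

lemma exists_chn {P : Finset Pt} {φ : Pt → Pt → ℝ} (hφ : EdgeOrderOn P φ) (K : ℕ)
    (hP : 2 ^ ((K + 1) ^ 2) < P.card) :
    ∃ u v, Chn P φ (· < ·) K u v ∨ Chn P φ (· > ·) K u v := by
  classical
  by_contra! hno
  have shorten : ∀ (R : ℝ → ℝ → Prop), (∀ u v, ¬ Chn P φ R K u v) →
      ∀ k u v, Chn P φ R k u v → k ≤ K := by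
    intro R hR
    have : ∀ j u v, ¬ Chn P φ R (K + j) u v := by
      intro j
      induction j with
      | zero => exact hR
      | succ j ih =>
        intro u v h
        cases h with
        | step _ u' _ _ h => exact ih _ _ h
    intro k u v h
    by_contra hk
    refine this (k - K) u v ?_
    rwa [show K + (k - K) = k by omega]
  have hA := shorten _ (fun u v => (hno u v).1)
  have hB := shorten _ (fun u v => (hno u v).2)
  let D : Pt → Finset (ℕ × ℕ) := fun v =>
    (Finset.range (K + 1) ×ˢ Finset.range (K + 1)).filter fun ab =>
      ∃ u ∈ P, toLex u < toLex v ∧ Chn P φ (· < ·) ab.1 u v ∧ Chn P φ (· > ·) ab.2 u v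
  have hD : ∀ v ∈ P, ∀ w ∈ P, toLex v < toLex w → D v ≠ D w := by
    intro v hv w hw hvw heq
    let a := Nat.findGreatest (fun k => Chn P φ (· < ·) k v w) K
    let b := Nat.findGreatest (fun k => Chn P φ (· > ·) k v w) K
    have ha : Chn P φ (· < ·) a v w :=
      Nat.findGreatest_spec (P := fun k => Chn P φ (· < ·) k v w) (Nat.zero_le K)
        (Chn.base v w hv hw hvw)
    have hb : Chn P φ (· > ·) b v w :=
      Nat.findGreatest_spec (P := fun k => Chn P φ (· > ·) k v w) (Nat.zero_le K)
        (Chn.base v w hv hw hvw)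
    have hmem : (a, b) ∈ D w := by
      simp only [D, Finset.mem_filter, Finset.mem_product, Finset.mem_range]
      exact ⟨⟨Nat.lt_succ_of_le (hA _ _ _ ha), Nat.lt_succ_of_le (hB _ _ _ hb)⟩, v, hv, hvw, ha, hb⟩
    rw [← heq] at hmem
    simp only [D, Finset.mem_filter] at hmem
    obtain ⟨-, u, hu, huv, h1, h2⟩ := hmem
    rcases lt_trichotomy (φ u v) (φ v w) with h | h | h
    · have h' := Chn.step a u v w h1 hw hvw h
      have := Nat.le_findGreatest (P := fun k => Chn P φ (· < ·) k v w) (hA _ _ _ h') h'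
      change a + 1 ≤ a at this
      omega
    · have hne1 : u ≠ v := by rintro rfl; exact lt_irrefl _ huv
      have hne2 : v ≠ w := by rintro rfl; exact lt_irrefl _ hvw
      have hs := hφ.2 u hu v hv v hv w hw hne1 hne2 h
      have : u ∈ ({v, w} : Set Pt) := by rw [← hs]; simp
      rcases this with h | h
      · exact hne1 h
      · rw [Set.mem_singleton_iff] at h
        subst h
        exact lt_asymm huv hvw
    · have h' := Chn.step b u v w h2 hw hvw h
      have := Nat.le_findGreatest (P := fun k => Chn P φ (· > ·) k v w) (hB _ _ _ h') h'
      change b + 1 ≤ b at this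
      omega
  have hcard : P.card ≤ (Finset.range (K + 1) ×ˢ Finset.range (K + 1)).powerset.card := by
    refine Finset.card_le_card_of_injOn D ?_ ?_
    · intro v _
      exact Finset.mem_coe.2 (Finset.mem_powerset.2 (Finset.filter_subset _ _))
    · intro v hv w hw h
      rcases lt_trichotomy (toLex v) (toLex w) with h' | h' | h'
      · exact absurd h (hD v hv w hw h')
      · exact toLex.injective h'
      · exact absurd h.symm (hD w hw v hv h')
  rw [Finset.card_powerset, Finset.card_product, Finset.card_range, ← sq] at hcard
  omega

/-- `ᾱ(Kₙ) = Ω(log log n)`: there is `c > 0` such that every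
edge-ordering of the complete geometric graph on any `n` points in general position
(`n ≥ 2`) admits a non-crossing monotone path of length at least `c·log log n`. -/
theorem stmt3 : ∃ c : ℝ, 0 < c ∧
    ∀ n : ℕ, 2 ≤ n → ∀ P : Finset Pt, P.card = n → GeneralPosition ↑P →
      ∀ φ : Pt → Pt → ℝ, EdgeOrderOn P φ →
        ∃ (k : ℕ) (v : Fin (k + 1) → Pt),
          IsNCPath P k v ∧ PathMonotone φ k v ∧
          c * Real.log (Real.log n) ≤ (k : ℝ) := by
  refine ⟨1 / 2, by norm_num, ?_⟩
  intro n hn P hcard _ φ hφ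
  rcases hL : ⌈(1 / 2 : ℝ) * Real.log (Real.log n)⌉₊ with _ | K
  · have hne : P.Nonempty := by
      rw [← Finset.card_pos]
      omega
    obtain ⟨p, hp⟩ := hne
    refine ⟨0, fun _ => p, ⟨fun _ => hp, fun i j _ => Subsingleton.elim (α := Fin 1) i j,
      fun i => i.elim0⟩, Or.inl (fun i => i.elim0), ?_⟩
    rw [Nat.ceil_eq_zero] at hL
    exact_mod_cast hL
  · have hle : (1 / 2 : ℝ) * Real.log (Real.log n) ≤ ((K + 1 : ℕ) : ℝ) := by
      rw [← hL]
      exact Nat.le_ceil _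
    have hlt : (K : ℝ) < (1 / 2 : ℝ) * Real.log (Real.log n) := by
      rw [← Nat.lt_ceil]
      omega
    have hn1 : (1 : ℝ) < n := by exact_mod_cast hn
    have hlog : 0 < Real.log n := Real.log_pos hn1
    have h1 : Real.exp (2 * K) < Real.log n := by
      rw [← Real.lt_log_iff_exp_lt hlog]
      linarith
    have h2 : ((K : ℝ) + 1) ^ 2 ≤ Real.exp (2 * K) := by
      have h := Real.add_one_le_exp (K : ℝ)
      calc ((K : ℝ) + 1) ^ 2 ≤ Real.exp K ^ 2 := by gcongr
        _ = Real.exp (2 * K) := by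
          rw [← Real.exp_nat_mul]
          norm_num
    have h3 : ((2 : ℝ) ^ ((K + 1) ^ 2)) < n := by
      rw [← Real.log_lt_log_iff (by positivity) (by linarith), Real.log_pow]
      have h4 : Real.log 2 < 1 := by
        have := Real.log_two_lt_d9
        linarith
      push_cast
      nlinarith [sq_nonneg ((K : ℝ) + 1)]
    have h5 : 2 ^ ((K + 1) ^ 2) < P.card := by
      rw [hcard]
      exact_mod_cast h3
    obtain ⟨u, v, h | h⟩ := exists_chn hφ K h5
    · obtain ⟨q, hq, hm⟩ := h.path
      exact ⟨K + 1, q, hq, Or.inl (Fin.strictMono_iff_lt_succ.2 hm), hle⟩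
    · obtain ⟨q, hq, hm⟩ := h.path
      exact ⟨K + 1, q, hq, Or.inr (Fin.strictAnti_iff_succ_lt.2 hm), hle⟩
end

section
/- There is a constant C > 0 such that for every n ≥ 2 and every set P of n points in the plane in convex position, there exists an edge-ordering φ of the complete geometric graph on P under which every non-crossing monotone path has length at most C·log n. (Hence ᾱ(K_n) = O(log n), where ᾱ(K_n) is the minimum over straight-line drawings of K_n and over edge-orderings of the maximum length of a non-crossing monotone path.) -/
/-! ### Combinatorial part -/

lemma exD (a b : ℕ) : ∃ k, a / 2 ^ k = b / 2 ^ k := by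
  refine ⟨a + b, ?_⟩
  have h : a + b < 2 ^ (a + b) := Nat.lt_two_pow_self
  rw [Nat.div_eq_of_lt (by omega), Nat.div_eq_of_lt (by omega)]

/-- Depth at which `a` and `b` are separated in the binary tree of dyadic intervals. -/
def dep (a b : ℕ) : ℕ := Nat.find (exD a b)

lemma dep_comm (a b : ℕ) : dep a b = dep b a := by
  unfold dep
  congr 1
  funext k
  exact propext eq_comm

lemma dep_pos {a b : ℕ} (h : a ≠ b) : 1 ≤ dep a b := by
  unfold dep
  rw [Nat.one_le_iff_ne_zero]
  intro h0
  rw [Nat.find_eq_zero] at h0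
  simp at h0
  exact h h0

lemma dep_le {a b K : ℕ} (ha : a < 2 ^ K) (hb : b < 2 ^ K) : dep a b ≤ K := by
  unfold dep
  apply Nat.find_min'
  rw [Nat.div_eq_of_lt ha, Nat.div_eq_of_lt hb]

lemma dep_spec {a b k : ℕ} (h : dep a b = k + 1) :
    a / 2 ^ k ≠ b / 2 ^ k ∧ a / 2 ^ k / 2 = b / 2 ^ k / 2 := by
  unfold dep at h
  have h1 := Nat.find_spec (exD a b)
  rw [h] at h1
  refine ⟨Nat.find_min (exD a b) (by omega), ?_⟩
  rwa [Nat.div_div_eq_div_mul, Nat.div_div_eq_div_mul, ← pow_succ]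

/-- The label. -/
def lab (N a b : ℕ) : ℕ := (dep a b * N + min a b) * N + max a b

lemma lab_comm (N a b : ℕ) : lab N a b = lab N b a := by
  unfold lab
  rw [dep_comm, min_comm, max_comm]

lemma lex_lt {N a b x y : ℕ} (h : a < b) (hx : x < N) : a * N + x < b * N + y := by
  have : (a + 1) * N ≤ b * N := Nat.mul_le_mul_right _ h
  nlinarith

lemma lab_dep_lt {N a b c d : ℕ} (ha : a < N) (hb : b < N)
    (h : dep a b < dep c d) : lab N a b < lab N c d := by
  unfold lab
  exact lex_lt (lex_lt h (lt_of_le_of_lt (min_le_left _ _) ha)) (max_lt ha hb)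

lemma lex_inj {N a b x y : ℕ} (hx : x < N) (hy : y < N) (h : a * N + x = b * N + y) :
    a = b ∧ x = y := by
  rcases lt_trichotomy a b with h1 | h1 | h1
  · have := lex_lt (y := y) h1 hx
    omega
  · subst h1
    exact ⟨rfl, by omega⟩
  · have := lex_lt (y := x) h1 hy
    omega

lemma lab_inj {N a b c d : ℕ} (ha : a < N) (hb : b < N) (hc : c < N) (hd : d < N)
    (h : lab N a b = lab N c d) : (a = c ∧ b = d) ∨ (a = d ∧ b = c) := by
  unfold lab at h
  obtain ⟨h1, h2⟩ := lex_inj (max_lt ha hb) (max_lt hc hd) h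
  obtain ⟨_, h3⟩ := lex_inj (lt_of_le_of_lt (min_le_left _ _) ha)
    (lt_of_le_of_lt (min_le_left _ _) hc) h1
  omega

/-- Interleaving pairs. -/
def Interleave (a b c d : ℕ) : Prop :=
  min a b < min c d ∧ min c d < max a b ∧ max a b < max c d

lemma sep {a b c d k : ℕ} (h1 : dep a b = k + 1) (h2 : dep b c = k + 1) (h3 : dep c d = k + 1) :
    (a < b ∧ a < d ∧ c < b ∧ c < d) ∨ (b < a ∧ d < a ∧ b < c ∧ d < c) := by
  obtain ⟨p1, q1⟩ := dep_spec h1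
  obtain ⟨p2, q2⟩ := dep_spec h2
  obtain ⟨p3, q3⟩ := dep_spec h3
  have key : ∀ x y : ℕ, x / 2 ^ k < y / 2 ^ k → x < y := by
    intro x y hxy
    by_contra hc
    exact absurd (Nat.div_le_div_right (c := 2 ^ k) (not_lt.mp hc)) (not_le.mpr hxy)
  rcases lt_or_gt_of_ne p1 with h | h
  · left
    refine ⟨key _ _ ?_, key _ _ ?_, key _ _ ?_, key _ _ ?_⟩ <;> omega
  · right
    refine ⟨key _ _ ?_, key _ _ ?_, key _ _ ?_, key _ _ ?_⟩ <;> omega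

lemma three {N a b c d k : ℕ} (h1 : dep a b = k + 1) (h2 : dep b c = k + 1)
    (h3 : dep c d = k + 1) (hN : 0 < N)
    (n1 : ¬ Interleave a b c d) (n2 : ¬ Interleave c d a b) (hac : a ≠ c) (hbd : b ≠ d) :
    ¬ (lab N a b < lab N b c ∧ lab N b c < lab N c d) ∧
    ¬ (lab N b c < lab N a b ∧ lab N c d < lab N b c) := by
  have hs := sep h1 h2 h3
  unfold Interleave at n1 n2
  unfold lab
  rw [h1, h2, h3]
  have mono : ∀ x y z : ℕ, ((k + 1) * N + x) * N + z < ((k + 1) * N + y) * N + z → x < y := by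
    intro x y z h
    by_contra hc
    have := Nat.mul_le_mul_right N (Nat.add_le_add_left (not_lt.mp hc) ((k + 1) * N))
    omega
  rcases hs with ⟨s1, s2, s3, s4⟩ | ⟨s1, s2, s3, s4⟩
  · rw [min_eq_left s1.le, max_eq_right s1.le, min_eq_right s3.le, max_eq_left s3.le,
      min_eq_left s4.le, max_eq_right s4.le]
    rw [min_eq_left s1.le, max_eq_right s1.le, min_eq_left s4.le, max_eq_right s4.le] at n1 n2
    constructor
    · rintro ⟨u, v⟩
      have := mono _ _ _ u
      omega
    · rintro ⟨u, v⟩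
      have := mono _ _ _ u
      omega
  · rw [min_eq_right s1.le, max_eq_left s1.le, min_eq_left s3.le, max_eq_right s3.le,
      min_eq_right s4.le, max_eq_left s4.le]
    rw [min_eq_right s1.le, max_eq_left s1.le, min_eq_right s4.le, max_eq_left s4.le] at n1 n2
    constructor
    · rintro ⟨u, v⟩
      have := mono _ _ _ v
      omega
    · rintro ⟨u, v⟩
      have := mono _ _ _ v
      omega

lemma comb {N K k : ℕ} (w : ℕ → ℕ) (hNK : N ≤ 2 ^ K)
    (hw : ∀ i ≤ k, w i < N) (hinj : ∀ i ≤ k, ∀ j ≤ k, w i = w j → i = j)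
    (hnc : ∀ i < k, ∀ j < k, ¬ Interleave (w i) (w (i + 1)) (w j) (w (j + 1)))
    (hmono : (∀ i, i + 1 < k → lab N (w i) (w (i + 1)) < lab N (w (i + 1)) (w (i + 2))) ∨
      (∀ i, i + 1 < k → lab N (w (i + 1)) (w (i + 2)) < lab N (w i) (w (i + 1)))) :
    k ≤ 2 * K := by
  by_contra hk
  push Not at hk
  have hN : 0 < N := lt_of_le_of_lt (Nat.zero_le _) (hw 0 (by omega))
  set f : ℕ → ℕ := fun i => dep (w i) (w (i + 1)) with hf
  have fpos : ∀ i < k, 1 ≤ f i := by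
    intro i hi
    apply dep_pos
    intro h
    have := hinj i (by omega) (i + 1) (by omega) h
    omega
  have fle : ∀ i < k, f i ≤ K := by
    intro i hi
    exact dep_le (lt_of_lt_of_le (hw i (by omega)) hNK)
      (lt_of_lt_of_le (hw (i + 1) (by omega)) hNK)
  have h3 : ∀ i, i + 2 < k → f i = f (i + 1) → f (i + 1) = f (i + 2) → False := by
    intro i hi e1 e2
    obtain ⟨m, hm⟩ : ∃ m, f i = m + 1 := ⟨f i - 1, by have := fpos i (by omega); omega⟩
    have t := three (N := N) (k := m) hm (e1.symm.trans hm) (e2.symm.trans (e1.symm.trans hm)) hN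
      (hnc i (by omega) (i + 2) (by omega)) (hnc (i + 2) (by omega) i (by omega))
      (fun h => by have := hinj i (by omega) (i + 2) (by omega) h; omega)
      (fun h => by have := hinj (i + 1) (by omega) (i + 3) (by omega) h; omega)
    rcases hmono with hm | hm
    · exact t.1 ⟨hm i (by omega), hm (i + 1) (by omega)⟩
    · exact t.2 ⟨hm i (by omega), hm (i + 1) (by omega)⟩
  rcases hmono with hm | hm
  · have step : ∀ i, i + 1 < k → f i ≤ f (i + 1) := by
      intro i hi
      by_contra hc
      have := lab_dep_lt (N := N) (hw (i + 1) (by omega)) (hw (i + 2) (by omega)) (not_le.mp hc)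
      have := hm i hi
      omega
    have grow : ∀ m, 2 * m < k → m + 1 ≤ f (2 * m) := by
      intro m
      induction m with
      | zero => intro h; exact fpos 0 h
      | succ m ih =>
        intro h
        have a := ih (by omega)
        have b := step (2 * m) (by omega)
        have c := step (2 * m + 1) (by omega)
        have d := h3 (2 * m) (by omega)
        rw [show 2 * (m + 1) = 2 * m + 2 by ring]
        rw [show 2 * m + 1 + 1 = 2 * m + 2 by ring] at c
        by_contra hc
        exact d (by omega) (by omega)
    have := grow K hk
    have := fle (2 * K) hk
    omega
  · have step : ∀ i, i + 1 < k → f (i + 1) ≤ f i := by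
      intro i hi
      by_contra hc
      have h1 := lab_dep_lt (N := N) (hw i (by omega)) (hw (i + 1) (by omega)) (not_le.mp hc)
      exact lt_asymm h1 (hm i hi)
    have grow : ∀ m, 2 * m < k → m + f (2 * m) ≤ K := by
      intro m
      induction m with
      | zero => intro h; simpa using fle 0 h
      | succ m ih =>
        intro h
        have a := ih (by omega)
        have b := step (2 * m) (by omega)
        have c := step (2 * m + 1) (by omega)
        have d := h3 (2 * m) (by omega)
        rw [show 2 * (m + 1) = 2 * m + 2 by ring]
        rw [show 2 * m + 1 + 1 = 2 * m + 2 by ring] at c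
        by_contra hc
        exact d (by omega) (by omega)
    have := grow K hk
    have := fpos (2 * K) hk
    omega

/-! ### Geometric part -/

/-- Orientation determinant. -/
def ori (a b c : Pt) : ℝ := (b.1 - a.1) * (c.2 - a.2) - (b.2 - a.2) * (c.1 - a.1)

lemma conv_mem_segment {a b x : Pt} (s t S : ℝ) (hs : 0 ≤ s) (ht : 0 ≤ t) (hS : 0 < S)
    (hst : s + t = S) (h1 : S * x.1 = s * a.1 + t * b.1) (h2 : S * x.2 = s * a.2 + t * b.2) :
    x ∈ segment ℝ a b := by
  refine ⟨s / S, t / S, by positivity, by positivity, ?_, ?_⟩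
  · rw [← add_div, hst, div_self hS.ne']
  · ext
    · simp
      field_simp
      linarith
    · simp
      field_simp
      linarith

lemma not_seg {P : Finset Pt} (hP : ConvexPosition (P : Set Pt)) {x a b : Pt}
    (hx : x ∈ P) (ha : a ∈ P) (hb : b ∈ P) (hxa : x ≠ a) (hxb : x ≠ b) :
    x ∉ segment ℝ a b := by
  intro h
  apply hP x hx
  exact (convex_convexHull ℝ _).segment_subset
    (subset_convexHull ℝ _ (show a ∈ (P : Set Pt) \ {x} from ⟨ha, fun h => hxa h.symm⟩))
    (subset_convexHull ℝ _ (show b ∈ (P : Set Pt) \ {x} from ⟨hb, fun h => hxb h.symm⟩)) h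

lemma cross_of_ori {P : Finset Pt} (hP : ConvexPosition (P : Set Pt)) {a b c d : Pt}
    (ha : a ∈ P) (hb : b ∈ P) (hd : d ∈ P)
    (hab : a ≠ b) (had : a ≠ d) (hbc : b ≠ c) (hcd : c ≠ d) (hc : c ∈ P)
    (h1 : 0 < ori a b c) (h2 : 0 < ori a b d) (h3 : 0 < ori a c d) (h4 : 0 < ori b c d) :
    ∃ x, x ∈ segment ℝ a c ∧ x ∈ segment ℝ b d ∧ x ≠ a ∧ x ≠ b ∧ x ≠ c ∧ x ≠ d := by
  have hS : 0 < ori b c d + ori a b d := by linarith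
  set x : Pt := ((ori b c d * a.1 + ori a b d * c.1) / (ori b c d + ori a b d),
    (ori b c d * a.2 + ori a b d * c.2) / (ori b c d + ori a b d)) with hx
  have e1 : (ori b c d + ori a b d) * x.1 = ori b c d * a.1 + ori a b d * c.1 := by
    rw [hx]; field_simp
  have e2 : (ori b c d + ori a b d) * x.2 = ori b c d * a.2 + ori a b d * c.2 := by
    rw [hx]; field_simp
  have m1 : x ∈ segment ℝ a c := conv_mem_segment _ _ _ h4.le h2.le hS rfl e1 e2
  have m2 : x ∈ segment ℝ b d := by
    refine conv_mem_segment (ori a c d) (ori a b c) _ h3.le h1.le hS ?_ ?_ ?_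
    · unfold ori; ring
    · rw [e1]; unfold ori; ring
    · rw [e2]; unfold ori; ring
  refine ⟨x, m1, m2, ?_, ?_, ?_, ?_⟩
  · intro h; rw [h] at m2; exact not_seg hP ha hb hd hab had m2
  · intro h; rw [h] at m1; exact not_seg hP hb ha hc hab.symm hbc m1
  · intro h; rw [h] at m2; exact not_seg hP hc hb hd hbc.symm hcd m2
  · intro h; rw [h] at m1; exact not_seg hP hd ha hc had.symm hcd.symm m1

/-- `x` is lexicographically larger than `o`. -/
def LexGt (o x : Pt) : Prop := o.1 < x.1 ∨ (o.1 = x.1 ∧ o.2 < x.2)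

lemma exists_lexmin (P : Finset Pt) (h : P.Nonempty) :
    ∃ o ∈ P, ∀ x ∈ P, x ≠ o → LexGt o x := by
  obtain ⟨o, ho, hmin⟩ := P.exists_min_image (fun p : Pt => toLex p) h
  refine ⟨o, ho, fun x hx hne => ?_⟩
  have h1 := hmin x hx
  rw [Prod.Lex.toLex_le_toLex] at h1
  rcases h1 with h1 | ⟨h1, h2⟩
  · exact Or.inl h1
  · refine Or.inr ⟨h1, lt_of_le_of_ne h2 ?_⟩
    intro h3
    exact hne (Prod.ext h1.symm h3.symm)

lemma ori_ne {P : Finset Pt} (hP : ConvexPosition (P : Set Pt)) {o a b : Pt}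
    (ho : o ∈ P) (ha : a ∈ P) (hb : b ∈ P) (hab : a ≠ b)
    (hoa : LexGt o a) (hob : LexGt o b) (hao : a ≠ o) (hbo : b ≠ o) : ori o a b ≠ 0 := by
  intro h
  unfold ori at h
  have A := not_seg hP ha ho hb hao hab
  have B := not_seg hP hb ho ha hbo hab.symm
  rcases hoa with h1 | ⟨h1, h1'⟩ <;> rcases hob with h2 | ⟨h2, h2'⟩
  · rcases le_total a.1 b.1 with h3 | h3
    · apply A
      refine conv_mem_segment (b.1 - a.1) (a.1 - o.1) (b.1 - o.1) ?_ ?_ ?_ ?_ ?_ ?_ <;> linarith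
    · apply B
      refine conv_mem_segment (a.1 - b.1) (b.1 - o.1) (a.1 - o.1) ?_ ?_ ?_ ?_ ?_ ?_ <;> linarith
  · rw [← h2] at h
    have : 0 < (a.1 - o.1) * (b.2 - o.2) := mul_pos (by linarith) (by linarith)
    linarith
  · rw [← h1] at h
    have : 0 < (a.2 - o.2) * (b.1 - o.1) := mul_pos (by linarith) (by linarith)
    linarith
  · rcases le_total a.2 b.2 with h3 | h3
    · apply A
      refine conv_mem_segment (b.2 - a.2) (a.2 - o.2) (b.2 - o.2) ?_ ?_ ?_ ?_ ?_ ?_ <;> linarith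
    · apply B
      refine conv_mem_segment (a.2 - b.2) (b.2 - o.2) (a.2 - o.2) ?_ ?_ ?_ ?_ ?_ ?_ <;> linarith

lemma ori_trans {o a b c : Pt} (ha : LexGt o a) (hb : LexGt o b) (hc : LexGt o c)
    (h1 : 0 < ori o a b) (h2 : 0 < ori o b c) : 0 < ori o a c := by
  have key : (b.1 - o.1) * ori o a c = ori o a b * (c.1 - o.1) + ori o b c * (a.1 - o.1) := by
    unfold ori; ring
  have hc0 : 0 ≤ c.1 - o.1 := by
    rcases hc with h | ⟨h, _⟩ <;> linarith
  rcases hb with hb | ⟨hb, hb'⟩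
  · have ha0 : 0 < a.1 - o.1 ∨ 0 < c.1 - o.1 := by
      rcases ha with h | ⟨h, h'⟩
      · left; linarith
      · exfalso
        unfold ori at h1
        rw [← h] at h1
        have : 0 < (a.2 - o.2) * (b.1 - o.1) := mul_pos (by linarith) (by linarith)
        linarith
    have ha1 : 0 ≤ a.1 - o.1 := by
      rcases ha with h | ⟨h, _⟩ <;> linarith
    have : 0 < (b.1 - o.1) * ori o a c := by
      rw [key]
      rcases ha0 with h | h
      · have := mul_pos h2 h
        have := mul_nonneg h1.le hc0
        linarith
      · have := mul_pos h1 h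
        have := mul_nonneg h2.le ha1
        linarith
    exact pos_of_mul_pos_right this (by linarith)
  · exfalso
    unfold ori at h2
    rw [← hb] at h2
    have : 0 ≤ (b.2 - o.2) * (c.1 - o.1) := mul_nonneg (by linarith) hc0
    linarith

lemma ori_pos_of {P : Finset Pt} (hP : ConvexPosition (P : Set Pt)) {o a b c : Pt}
    (ho : o ∈ P) (ha : a ∈ P) (hb : b ∈ P) (hc : c ∈ P)
    (hbo : b ≠ o) (hba : b ≠ a) (hbc : b ≠ c)
    (h1 : 0 < ori o a b) (h2 : 0 < ori o b c) (h3 : 0 < ori o a c) : 0 < ori a b c := by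
  by_contra hn
  push Not at hn
  apply hP b hb
  have mo : o ∈ convexHull ℝ ((P : Set Pt) \ {b}) :=
    subset_convexHull ℝ _ ⟨ho, fun h => hbo h.symm⟩
  have ma : a ∈ convexHull ℝ ((P : Set Pt) \ {b}) :=
    subset_convexHull ℝ _ ⟨ha, fun h => hba h.symm⟩
  have mc : c ∈ convexHull ℝ ((P : Set Pt) \ {b}) :=
    subset_convexHull ℝ _ ⟨hc, fun h => hbc h.symm⟩
  have hT : 0 < ori o a b + ori o b c := by linarith
  -- a point on the segment `a c`
  set y : Pt := ((ori o b c * a.1 + ori o a b * c.1) / (ori o b c + ori o a b),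
    (ori o b c * a.2 + ori o a b * c.2) / (ori o b c + ori o a b)) with hy
  have hT' : 0 < ori o b c + ori o a b := by linarith
  have e1 : (ori o b c + ori o a b) * y.1 = ori o b c * a.1 + ori o a b * c.1 := by
    rw [hy]; field_simp
  have e2 : (ori o b c + ori o a b) * y.2 = ori o b c * a.2 + ori o a b * c.2 := by
    rw [hy]; field_simp
  have my : y ∈ segment ℝ a c := conv_mem_segment _ _ _ h2.le h1.le hT' rfl e1 e2
  have my' := (convex_convexHull ℝ _).segment_subset ma mc my
  refine (convex_convexHull ℝ _).segment_subset mo my' ?_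
  refine conv_mem_segment (-ori a b c) (ori o b c + ori o a b) (ori o a c)
    (by linarith) hT'.le h3 ?_ ?_ ?_
  · unfold ori; ring
  · rw [e1]; unfold ori; ring
  · rw [e2]; unfold ori; ring

/-- The angular order around `o`. -/
def Bef (o q p : Pt) : Prop := (q = o ∧ p ≠ o) ∨ (q ≠ o ∧ p ≠ o ∧ 0 < ori o q p)

lemma exists_index (P : Finset Pt) (hne : P.Nonempty) (hP : ConvexPosition (P : Set Pt)) :
    ∃ idx : Pt → ℕ, (∀ p ∈ P, idx p < P.card) ∧ (∀ p ∈ P, ∀ q ∈ P, idx p = idx q → p = q) ∧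
      ∀ a ∈ P, ∀ b ∈ P, ∀ c ∈ P, idx a < idx b → idx b < idx c → 0 < ori a b c := by
  classical
  obtain ⟨o, ho, hmin⟩ := exists_lexmin P hne
  have irr : ∀ p, ¬ Bef o p p := by
    intro p h
    rcases h with ⟨h1, h2⟩ | ⟨_, _, h⟩
    · exact h2 h1
    · unfold ori at h
      linarith
  have tr : ∀ a ∈ P, ∀ b ∈ P, ∀ c ∈ P, Bef o a b → Bef o b c → Bef o a c := by
    intro a ha b hb c hc hab hbc
    rcases hbc with ⟨h1, h2⟩ | ⟨h1, h2, h3⟩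
    · rcases hab with ⟨_, h⟩ | ⟨_, h, _⟩ <;> exact absurd h1 h
    · rcases hab with ⟨h, _⟩ | ⟨h, _, h'⟩
      · exact Or.inl ⟨h, h2⟩
      · exact Or.inr ⟨h, h2, ori_trans (hmin a ha h) (hmin b hb h1) (hmin c hc h2) h' h3⟩
  have tot : ∀ a ∈ P, ∀ b ∈ P, a ≠ b → Bef o a b ∨ Bef o b a := by
    intro a ha b hb hab
    by_cases hao : a = o
    · exact Or.inl (Or.inl ⟨hao, fun h => hab (hao.trans h.symm)⟩)
    by_cases hbo : b = o
    · exact Or.inr (Or.inl ⟨hbo, hao⟩)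
    rcases lt_or_gt_of_ne (ori_ne hP ho ha hb hab (hmin a ha hao) (hmin b hb hbo) hao hbo)
      with h | h
    · refine Or.inr (Or.inr ⟨hbo, hao, ?_⟩)
      unfold ori at h ⊢
      linarith
    · exact Or.inl (Or.inr ⟨hao, hbo, h⟩)
  set idx : Pt → ℕ := fun p => (P.filter (fun q => Bef o q p)).card with hidx
  have mono : ∀ a ∈ P, ∀ b ∈ P, Bef o a b → idx a < idx b := by
    intro a ha b hb hab
    apply Finset.card_lt_card
    rw [Finset.ssubset_iff_of_subset]
    · exact ⟨a, Finset.mem_filter.mpr ⟨ha, hab⟩, fun h => irr a (Finset.mem_filter.mp h).2⟩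
    · intro q hq
      rw [Finset.mem_filter] at hq ⊢
      exact ⟨hq.1, tr q hq.1 a ha b hb hq.2 hab⟩
  have rev : ∀ a ∈ P, ∀ b ∈ P, idx a < idx b → Bef o a b := by
    intro a ha b hb hab
    rcases tot a ha b hb (fun h => by rw [h] at hab; exact lt_irrefl _ hab) with h | h
    · exact h
    · exact absurd (mono b hb a ha h) (by omega)
  refine ⟨idx, ?_, ?_, ?_⟩
  · intro p hp
    apply Finset.card_lt_card
    rw [Finset.ssubset_iff_of_subset (Finset.filter_subset _ _)]
    exact ⟨p, hp, fun h => irr p (Finset.mem_filter.mp h).2⟩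
  · intro p hp q hq h
    by_contra hne
    rcases tot p hp q hq hne with h' | h'
    · exact absurd (mono p hp q hq h') (by omega)
    · exact absurd (mono q hq p hp h') (by omega)
  · intro a ha b hb c hc hab hbc
    have hac := rev a ha c hc (hab.trans hbc)
    have nab : b ≠ a := fun h => by rw [h] at hab; exact lt_irrefl _ hab
    have nbc : b ≠ c := fun h => by rw [h] at hbc; exact lt_irrefl _ hbc
    have hab := rev a ha b hb hab
    have hbc := rev b hb c hc hbc
    rcases hbc with ⟨h1, _⟩ | ⟨h1, h2, h3⟩
    · rcases hab with ⟨_, h⟩ | ⟨_, h, _⟩ <;> exact absurd h1 h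
    · rcases hab with ⟨h, _⟩ | ⟨h, _, h'⟩
      · rw [h]; exact h3
      · rcases hac with ⟨h4, _⟩ | ⟨_, _, h4⟩
        · exact absurd h4 h
        · exact ori_pos_of hP ho ha hb hc h1 nab nbc h' h3 h4

lemma noCross_swap_left {a b c d : Pt} (h : NoCross a b c d) : NoCross b a c d := by
  intro x hx hy
  rw [segment_symm] at hx
  have := h x hx hy
  tauto

lemma noCross_swap_right {a b c d : Pt} (h : NoCross a b c d) : NoCross a b d c := by
  intro x hx hy
  rw [segment_symm] at hy
  have := h x hx hy
  tauto

lemma not_inter {P : Finset Pt} (hP : ConvexPosition (P : Set Pt)) (idx : Pt → ℕ)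
    (hori : ∀ a ∈ P, ∀ b ∈ P, ∀ c ∈ P, idx a < idx b → idx b < idx c → 0 < ori a b c)
    {a b c d : Pt} (ha : a ∈ P) (hb : b ∈ P) (hc : c ∈ P) (hd : d ∈ P)
    (h : NoCross a b c d) : ¬ Interleave (idx a) (idx b) (idx c) (idx d) := by
  have main : ∀ a ∈ P, ∀ b ∈ P, ∀ c ∈ P, ∀ d ∈ P, NoCross a b c d →
      ¬ (idx a < idx c ∧ idx c < idx b ∧ idx b < idx d) := by
    rintro a ha b hb c hc d hd hn ⟨h1, h2, h3⟩
    have ne : ∀ x y : Pt, idx x < idx y → x ≠ y := by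
      intro x y hxy he
      rw [he] at hxy
      exact lt_irrefl _ hxy
    obtain ⟨x, m1, m2, n1, n2, n3, n4⟩ := cross_of_ori hP ha hc hd (ne _ _ h1)
      (ne _ _ (by omega)) (ne _ _ h2) (ne _ _ h3) hb
      (hori _ ha _ hc _ hb h1 h2) (hori _ ha _ hc _ hd h1 (by omega))
      (hori _ ha _ hb _ hd (by omega) h3) (hori _ hc _ hb _ hd h2 h3)
    rcases (hn x m1 m2).1 with h | h
    · exact n1 h
    · exact n3 h
  unfold Interleave
  rcases le_total (idx a) (idx b) with h1 | h1 <;> rcases le_total (idx c) (idx d) with h2 | h2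
  · rw [min_eq_left h1, max_eq_right h1, min_eq_left h2, max_eq_right h2]
    exact main a ha b hb c hc d hd h
  · rw [min_eq_left h1, max_eq_right h1, min_eq_right h2, max_eq_left h2]
    exact main a ha b hb d hd c hc (noCross_swap_right h)
  · rw [min_eq_right h1, max_eq_left h1, min_eq_left h2, max_eq_right h2]
    exact main b hb a ha c hc d hd (noCross_swap_left h)
  · rw [min_eq_right h1, max_eq_left h1, min_eq_right h2, max_eq_left h2]
    exact main b hb a ha d hd c hc (noCross_swap_left (noCross_swap_right h))

lemma clog_bound {n : ℕ} (hn : 2 ≤ n) :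
    (2 * Nat.clog 2 n : ℝ) ≤ 4 / Real.log 2 * Real.log n := by
  have h1 : 2 ^ (Nat.clog 2 n - 1) < n := Nat.pow_pred_clog_lt_self (by norm_num) (by omega)
  have hpos : 1 ≤ Nat.clog 2 n := Nat.clog_pos (by norm_num) hn
  obtain ⟨m, hm⟩ : ∃ m, Nat.clog 2 n = m + 1 := ⟨Nat.clog 2 n - 1, by omega⟩
  rw [hm] at h1 ⊢
  simp only [Nat.add_sub_cancel] at h1
  have hl2 : 0 < Real.log 2 := Real.log_pos (by norm_num)
  have h2 : (m : ℝ) * Real.log 2 ≤ Real.log n := by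
    rw [← Real.log_pow]
    apply Real.log_le_log (by positivity)
    exact_mod_cast h1.le
  have h3 : Real.log 2 ≤ Real.log n := by
    apply Real.log_le_log (by norm_num)
    exact_mod_cast hn
  rw [div_mul_eq_mul_div, le_div_iff₀ hl2]
  push_cast
  nlinarith

/-- `ᾱ(Kₙ) = O(log n)`: there is `C > 0` such that for every set of
`n ≥ 2` points in convex position there is an edge-ordering of the complete geometric
graph under which every non-crossing monotone path has length at most `C·log n`. -/
theorem stmt4 : ∃ C : ℝ, 0 < C ∧
    ∀ n : ℕ, 2 ≤ n → ∀ P : Finset Pt, P.card = n → ConvexPosition ↑P →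
      ∃ φ : Pt → Pt → ℝ, EdgeOrderOn P φ ∧
        ∀ (k : ℕ) (v : Fin (k + 1) → Pt),
          IsNCPath P k v → PathMonotone φ k v → (k : ℝ) ≤ C * Real.log n := by
  refine ⟨4 / Real.log 2, div_pos (by norm_num) (Real.log_pos (by norm_num)), ?_⟩
  intro n hn P hcard hP
  have hne : P.Nonempty := by
    rw [← Finset.card_pos]
    omega
  obtain ⟨idx, hlt, hinj, hori⟩ := exists_index P hne hP
  rw [hcard] at hlt
  refine ⟨fun p q => (lab n (idx p) (idx q) : ℝ), ⟨?_, ?_⟩, ?_⟩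
  · intro p q
    simp only
    rw [lab_comm]
  · intro p hp q hq r hr s hs _ _ h
    have h' : lab n (idx p) (idx q) = lab n (idx r) (idx s) := Nat.cast_injective (R := ℝ) h
    rcases lab_inj (hlt p hp) (hlt q hq) (hlt r hr) (hlt s hs) h' with ⟨h1, h2⟩ | ⟨h1, h2⟩
    · rw [hinj p hp r hr h1, hinj q hq s hs h2]
    · rw [hinj p hp s hs h1, hinj q hq r hr h2, Set.pair_comm]
  · intro k v hv hmono
    obtain ⟨hvP, hvinj, hvnc⟩ := hv
    refine le_trans ?_ (clog_bound hn)
    set w : ℕ → ℕ := fun i => if h : i < k + 1 then idx (v ⟨i, h⟩) else 0 with hw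
    have we : ∀ i (h : i < k + 1), w i = idx (v ⟨i, h⟩) := fun i h => by
      simp only [hw, dif_pos h]
    have key : k ≤ 2 * Nat.clog 2 n := by
      apply comb (N := n) w (Nat.le_pow_clog (by norm_num) n)
      · intro i hi
        rw [we i (by omega)]
        exact hlt _ (hvP _)
      · intro i hi j hj h
        rw [we i (by omega), we j (by omega)] at h
        have := hvinj (hinj _ (hvP _) _ (hvP _) h)
        simpa using this
      · intro i hi j hj
        by_cases hij : i = j
        · subst hij
          unfold Interleave
          omega
        · rw [we i (by omega), we j (by omega), we (i + 1) (by omega), we (j + 1) (by omega)]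
          apply not_inter hP idx hori (hvP _) (hvP _) (hvP _) (hvP _)
          exact hvnc ⟨i, hi⟩ ⟨j, hj⟩ (by simpa using hij)
      · rcases hmono with hm | hm
        · left
          intro i hi
          rw [we i (by omega), we (i + 1) (by omega), we (i + 2) (by omega)]
          have := hm (a := ⟨i, by omega⟩) (b := ⟨i + 1, hi⟩) (by simp)
          exact Nat.cast_lt (α := ℝ).mp this
        · right
          intro i hi
          rw [we i (by omega), we (i + 1) (by omega), we (i + 2) (by omega)]
          have := hm (a := ⟨i, by omega⟩) (b := ⟨i + 1, hi⟩) (by simp)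
          exact Nat.cast_lt (α := ℝ).mp this
    exact_mod_cast key
end

section
/- There is a constant c > 0 such that for every sufficiently large n, every set P of n points in the plane in general position, and every edge-ordering φ of the complete geometric graph on P, there exists a non-crossing monotone embedded complete binary tree in the complete geometric graph on P of size at least c·log log log n. (That is, τ̄(K_n) = Ω(log log log n).) -/
namespace MT

/-- Orientation determinant. -/
def det (a b c : Pt) : ℝ := (b.1 - a.1) * (c.2 - a.2) - (b.2 - a.2) * (c.1 - a.1)

lemma det_swap (a b c : Pt) : det a c b = - det a b c := by unfold det; ring
lemma det_rot (a b c : Pt) : det b c a = det a b c := by unfold det; ring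

lemma det_ne {a b c : Pt} (hab : a ≠ b) (h : ¬ Collinear ℝ ({a, b, c} : Set Pt)) :
    det a b c ≠ 0 := by
  intro h0
  apply h
  rw [collinear_iff_of_mem (p₀ := a) (by simp)]
  refine ⟨b - a, ?_⟩
  unfold det at h0
  intro p hp
  simp only [Set.mem_insert_iff, Set.mem_singleton_iff] at hp
  rcases hp with rfl | rfl | rfl
  · exact ⟨0, by simp⟩
  · exact ⟨1, by simp⟩
  · by_cases h1 : b.1 - a.1 = 0
    · have h2 : b.2 - a.2 ≠ 0 := by
        intro h2
        exact hab (Prod.ext (by linarith) (by linarith))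
      refine ⟨(p.2 - a.2) / (b.2 - a.2), ?_⟩
      apply Prod.ext
      · rw [h1] at h0
        have : p.1 - a.1 = 0 := by
          rcases mul_eq_zero.1 (by linarith : (b.2 - a.2) * (p.1 - a.1) = 0) with h | h
          · exact absurd h h2
          · exact h
        simp [h1]; linarith
      · simp; field_simp; ring
    · refine ⟨(p.1 - a.1) / (b.1 - a.1), ?_⟩
      apply Prod.ext
      · simp; field_simp; ring
      · simp; field_simp; linarith

lemma det_seg {a b x c d : Pt} {u v : ℝ} (huv : u + v = 1) (hx : u • c + v • d = x) :
    det a b x = u * det a b c + v * det a b d := by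
  subst hx
  have : u = 1 - v := by linarith
  subst this
  unfold det
  simp
  ring

lemma det_self_left (a b : Pt) : det a b a = 0 := by unfold det; ring
lemma det_self_right (a b : Pt) : det a b b = 0 := by unfold det; ring

lemma noCross_side {ε : ℝ} {a b c d : Pt} (hc : 0 < ε * det a b c) (hd : 0 < ε * det a b d) :
    NoCross a b c d := by
  rintro x ⟨u, v, hu, hv, huv, hx⟩ ⟨u', v', hu', hv', huv', hx'⟩
  exfalso
  have h1 := det_seg (a := a) (b := b) huv hx
  have h2 := det_seg (a := a) (b := b) huv' hx'
  rw [det_self_left, det_self_right] at h1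
  have h3 : u' * (ε * det a b c) + v' * (ε * det a b d) = 0 := by
    have : det a b x = 0 := by linarith
    rw [this] at h2
    linear_combination (-ε) * h2
  have h4 := mul_nonneg hu' hc.le
  have h5 := mul_nonneg hv' hd.le
  have h6 : u' * (ε * det a b c) = 0 := by linarith
  have h7 : v' * (ε * det a b d) = 0 := by linarith
  have := (mul_eq_zero.1 h6).resolve_right hc.ne'
  have := (mul_eq_zero.1 h7).resolve_right hd.ne'
  linarith

lemma noCross_share {a b d : Pt} (h : det a b d ≠ 0) : NoCross a b a d := by
  rintro x ⟨u, v, hu, hv, huv, hx⟩ ⟨u', v', hu', hv', huv', hx'⟩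
  have h1 := det_seg (a := a) (b := b) huv hx
  have h2 := det_seg (a := a) (b := b) huv' hx'
  rw [det_self_left, det_self_right] at h1
  rw [det_self_left] at h2
  have h3 : v' * det a b d = 0 := by linarith
  have h4 : v' = 0 := (mul_eq_zero.1 h3).resolve_right h
  subst h4
  have : u' = 1 := by linarith
  subst this
  have : x = a := by rw [← hx']; simp
  exact ⟨Or.inl this, Or.inl this⟩

lemma nc_symm {a b c d : Pt} (h : NoCross a b c d) : NoCross c d a b :=
  fun x h1 h2 => (h x h2 h1).symm

lemma nc_swapl {a b c d : Pt} (h : NoCross a b c d) : NoCross b a c d :=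
  fun x h1 h2 => by
    rw [segment_symm] at h1
    exact ⟨(h x h1 h2).1.symm, (h x h1 h2).2⟩

lemma nc_swapr {a b c d : Pt} (h : NoCross a b c d) : NoCross a b d c :=
  nc_symm (nc_swapl (nc_symm h))

lemma seq_det_ne {m : ℕ} {q : ℕ → Pt} {ε : ℝ}
    (hq : ∀ i j k, i < j → j < k → k < m → 0 < ε * det (q i) (q j) (q k))
    {a b c : ℕ} (ha : a < m) (hb : b < m) (hc : c < m) (hab : a ≠ b) (hac : a ≠ c) (hbc : b ≠ c) :
    det (q a) (q b) (q c) ≠ 0 := by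
  intro h0
  have e1 := det_swap (q a) (q b) (q c)
  have e2 := det_rot (q a) (q b) (q c)
  have e3 := det_rot (q b) (q c) (q a)
  have e4 := det_swap (q b) (q c) (q a)
  have e5 := det_swap (q c) (q a) (q b)
  rcases lt_or_gt_of_ne hab with h1 | h1 <;> rcases lt_or_gt_of_ne hac with h2 | h2 <;>
    rcases lt_or_gt_of_ne hbc with h3 | h3
  · have := hq a b c h1 h3 hc
    simp_all
  · have := hq a c b h2 h3 hb
    simp_all
  · omega
  · have := hq c a b h2 h1 hb
    simp_all
  · have := hq b a c h1 h2 hc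
    simp_all
  · omega
  · have := hq b c a h3 h2 ha
    simp_all
  · have := hq c b a h3 h1 ha
    simp_all

lemma seq_noCross_lt {m : ℕ} {q : ℕ → Pt} {ε : ℝ}
    (hq : ∀ i j k, i < j → j < k → k < m → 0 < ε * det (q i) (q j) (q k))
    {a b c d : ℕ} (hb : b < m) (hd : d < m) (hab : a < b) (hcd : c < d)
    (hbd : b ≠ d) (hac : a < c) (hbc : b ≠ c) (hX : ¬ (a < c ∧ c < b ∧ b < d)) :
    NoCross (q a) (q b) (q c) (q d) := by
  rcases lt_or_gt_of_ne hbc with h | h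
  · exact noCross_side (hq a b c hab h (by omega)) (hq a b d hab (by omega) hd)
  · have h1 := hq a c b hac h hb
    have h2 := hq a d b (by omega) (by omega) hb
    rw [det_swap] at h1 h2
    exact noCross_side (ε := -ε) (by linarith) (by linarith)

lemma seq_noCross {m : ℕ} {q : ℕ → Pt} {ε : ℝ}
    (hq : ∀ i j k, i < j → j < k → k < m → 0 < ε * det (q i) (q j) (q k))
    {a b c d : ℕ} (hb : b < m) (hd : d < m) (hab : a < b) (hcd : c < d)
    (hbd : b ≠ d) (hX : ¬ (a < c ∧ c < b ∧ b < d)) (hX' : ¬ (c < a ∧ a < d ∧ d < b)) :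
    NoCross (q a) (q b) (q c) (q d) := by
  by_cases hac : a = c
  · subst hac
    exact noCross_share (seq_det_ne hq (by omega) hb hd (by omega) (by omega) hbd)
  by_cases hbc : b = c
  · subst hbc
    exact nc_swapl (noCross_share (seq_det_ne hq hb (by omega) hd (by omega) (by omega) (by omega)))
  by_cases had : a = d
  · subst had
    exact nc_swapr (noCross_share (seq_det_ne hq (by omega) hb (by omega) (by omega) (by omega)
      (by omega)))
  rcases lt_or_gt_of_ne hac with h | h
  · exact seq_noCross_lt hq hb hd hab hcd hbd h hbc hX
  · exact nc_symm (seq_noCross_lt hq hd hb hcd hab hbd.symm h (Ne.symm had) hX')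

/-! ### Preorder positions -/

/-- Depth of a heap index. -/
def dep (j : ℕ) : ℕ := Nat.log 2 (j + 1)

/-- Scaled left end of the dyadic interval of a heap index. -/
def lft (H j : ℕ) : ℕ := (j + 1) * 2 ^ (H - dep j)

/-- Position. -/
def pos (H j : ℕ) : ℕ := lft H j * (H + 1) + dep j

lemma lt_treeSize {H j : ℕ} : j < treeSize H ↔ j + 1 < 2 ^ (H + 1) := by
  unfold treeSize; omega

lemma dep_le {H j : ℕ} (h : j < treeSize H) : dep j ≤ H := by
  rw [lt_treeSize] at h
  unfold dep
  have := Nat.log_lt_of_lt_pow (b := 2) (by omega : j + 1 ≠ 0) h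
  omega

lemma pos_lt {H j : ℕ} (h : j < treeSize H) : pos H j < 2 ^ (H + 1) * (H + 1) := by
  have hd := dep_le h
  have h1 : j + 1 < 2 ^ (dep j + 1) := Nat.lt_pow_succ_log_self (by norm_num) _
  have h2 : lft H j < 2 ^ (H + 1) := by
    unfold lft
    have : 2 ^ (H + 1) = 2 ^ (dep j + 1) * 2 ^ (H - dep j) := by
      rw [← pow_add]; congr 1; omega
    rw [this]
    exact Nat.mul_lt_mul_of_pos_right h1 (by positivity)
  unfold pos
  calc lft H j * (H + 1) + dep j < (lft H j + 1) * (H + 1) := by rw [add_mul]; omega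
    _ ≤ _ := Nat.mul_le_mul_right _ h2

lemma pos_lt_pos {H i j : ℕ} (hi : dep i ≤ H) (hj : dep j ≤ H) :
    pos H i < pos H j ↔ lft H i < lft H j ∨ (lft H i = lft H j ∧ dep i < dep j) := by
  unfold pos
  constructor
  · intro h
    by_contra hc
    push Not at hc
    obtain ⟨h1, h2⟩ := hc
    rcases h1.lt_or_eq with h3 | h3
    · have : (lft H j + 1) * (H + 1) ≤ lft H i * (H + 1) := Nat.mul_le_mul_right _ h3
      rw [add_mul] at this
      omega
    · have := h2 h3.symm
      rw [h3] at h
      omega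
  · rintro (h | ⟨h, h'⟩)
    · have : (lft H i + 1) * (H + 1) ≤ lft H j * (H + 1) := Nat.mul_le_mul_right _ h
      rw [add_mul] at this
      omega
    · rw [h]; omega

lemma pos_inj {H i j : ℕ} (hi : dep i ≤ H) (hj : dep j ≤ H) (h : pos H i = pos H j) : i = j := by
  have h1 := pos_lt_pos hi hj
  have h2 := pos_lt_pos hj hi
  have h3 : lft H i = lft H j ∧ dep i = dep j := by omega
  obtain ⟨h3, h4⟩ := h3
  unfold lft at h3
  rw [h4] at h3
  have := Nat.eq_of_mul_eq_mul_right (by positivity) h3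
  omega

lemma dep_par {j : ℕ} (hj : 1 ≤ j) : dep j = dep (par j) + 1 := by
  unfold dep par
  have : (j - 1) / 2 + 1 = (j + 1) / 2 := by omega
  rw [this, Nat.log_div_base]
  have : 0 < Nat.log 2 (j + 1) := Nat.log_pos (by norm_num) (by omega)
  omega

lemma par_lt {H j : ℕ} (hj : j < treeSize H) : par j < treeSize H := by
  unfold par; omega

lemma lft_par {H j : ℕ} (hj : 1 ≤ j) (hd : dep j ≤ H) :
    (lft H j = lft H (par j) ∨ lft H j = lft H (par j) + 2 ^ (H - dep j)) ∧
    2 * 2 ^ (H - dep j) ∣ lft H (par j) := by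
  have h := dep_par hj
  have h1 : 2 ^ (H - dep (par j)) = 2 * 2 ^ (H - dep j) := by
    rw [← pow_succ']; congr 1; omega
  unfold lft
  rw [h1]
  refine ⟨?_, dvd_mul_left _ _⟩
  generalize 2 ^ (H - dep j) = u
  rcases Nat.even_or_odd' j with ⟨k, rfl | rfl⟩
  · right
    have : par (2 * k) = k - 1 := by unfold par; omega
    rw [this]
    obtain ⟨l, rfl⟩ : ∃ l, k = l + 1 := ⟨k - 1, by omega⟩
    simp; ring
  · left
    have : par (2 * k + 1) = k := by unfold par; omega
    rw [this]
    ring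

lemma pos_par_lt {H j : ℕ} (hj : 1 ≤ j) (hd : dep j ≤ H) : pos H (par j) < pos H j := by
  have h := dep_par hj
  rw [pos_lt_pos (by omega) hd]
  have := (lft_par hj hd).1
  have h2 : 0 < 2 ^ (H - dep j) := by positivity
  omega

lemma dvd_close {w x y : ℕ} (hx : w ∣ x) (hy : w ∣ y) (h1 : x ≤ y) (h2 : y < x + w) : x = y := by
  have h3 : w ∣ y - x := Nat.dvd_sub hy hx
  have := Nat.eq_zero_of_dvd_of_lt h3 (by omega)
  omega

lemma pos_noninter {H i j : ℕ} (hi : 1 ≤ i) (hj : 1 ≤ j) (hdi : dep i ≤ H) (hdj : dep j ≤ H) :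
    ¬ (pos H (par i) < pos H (par j) ∧ pos H (par j) < pos H i ∧ pos H i < pos H j) := by
  have ei := dep_par hi
  have ej := dep_par hj
  rw [pos_lt_pos (by omega) (by omega), pos_lt_pos (by omega) (by omega),
    pos_lt_pos (by omega) (by omega)]
  obtain ⟨ci, vi⟩ := lft_par hi hdi
  obtain ⟨cj, vj⟩ := lft_par hj hdj
  have hui : 0 < 2 ^ (H - dep i) := by positivity
  have huj : 0 < 2 ^ (H - dep j) := by positivity
  rintro ⟨h1, h2, h3⟩
  rcases ci with ci | ci
  · omega
  rcases cj with cj | cj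
  · omega
  rcases lt_trichotomy (dep i) (dep j) with h | h | h
  · skip
    have hv : 2 * 2 ^ (H - dep j) ∣ 2 ^ (H - dep i) := by
      rw [← pow_succ']; exact pow_dvd_pow _ (by omega)
    have hv2 : 2 * 2 ^ (H - dep j) ∣ lft H i := by
      rw [ci]; exact dvd_add (hv.trans (dvd_mul_left _ _ |>.trans vi)) hv
    have := dvd_close vj hv2 (by omega) (by omega)
    omega
  · rw [← h] at vj cj
    have := dvd_close vi vj (by omega) (by omega)
    omega
  · have hv : 2 * 2 ^ (H - dep i) ∣ 2 * 2 ^ (H - dep j) :=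
      Nat.mul_dvd_mul_left _ (pow_dvd_pow _ (by omega))
    have := dvd_close vi (hv.trans vj) (by omega) (by omega)
    omega

/-! ### Ramsey -/

open Finset in
lemma ramsey_pair {α : Type*} [LinearOrder α] (c : α → α → Bool × Bool) :
    ∀ (s : ℕ) (S : Finset α), 4 ^ s ≤ #S → ∃ T ⊆ S, #T = s ∧
      ∀ x ∈ T, ∀ y ∈ T, ∀ z ∈ T, x < y → x < z → c x y = c x z := by
  intro s
  induction s with
  | zero => intro S _; exact ⟨∅, by simp, by simp, by simp⟩
  | succ s ih =>
    intro S hS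
    have hne : S.Nonempty := by
      rw [← card_pos]; exact lt_of_lt_of_le (by positivity) hS
    set x := S.min' hne with hx
    have hxS : x ∈ S := S.min'_mem hne
    have hpos : 0 < 4 ^ s := by positivity
    obtain ⟨y, -, hy⟩ := exists_lt_card_fiber_of_mul_lt_card_of_maps_to
      (s := S.erase x) (t := (univ : Finset (Bool × Bool))) (f := fun z => c x z) (n := 4 ^ s - 1)
      (by simp) (by
        rw [card_erase_of_mem hxS]
        simp only [card_univ, Fintype.card_prod, Fintype.card_bool]
        rw [pow_succ] at hS
        omega)
    obtain ⟨T, hT, hc, hh⟩ := ih _ (Nat.le_of_pred_lt hy)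
    have hT' : ∀ z ∈ T, z ∈ S ∧ z ≠ x ∧ c x z = y := by
      intro z hz
      have := hT hz
      simp only [mem_filter, mem_erase] at this
      tauto
    have hlt : ∀ z ∈ T, x < z := fun z hz =>
      lt_of_le_of_ne (S.min'_le z (hT' z hz).1) (hT' z hz).2.1.symm
    have hxT : x ∉ T := fun h => (hT' x h).2.1 rfl
    refine ⟨insert x T, ?_, by rw [card_insert_of_notMem hxT, hc], ?_⟩
    · intro z hz
      rcases mem_insert.1 hz with rfl | h
      · exact hxS
      · exact (hT' z h).1
    · intro a ha b hb d hd hab had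
      rcases mem_insert.1 ha with ha | ha
      · subst ha
        have hb' := (mem_insert.1 hb).resolve_left hab.ne'
        have hd' := (mem_insert.1 hd).resolve_left had.ne'
        rw [(hT' b hb').2.2, (hT' d hd').2.2]
      · have hxa := hlt a ha
        have hb' := (mem_insert.1 hb).resolve_left (hxa.trans hab).ne'
        have hd' := (mem_insert.1 hd).resolve_left (hxa.trans had).ne'
        exact hh a ha b hb' d hd' hab had

open Finset in
lemma ramsey_pair' {α : Type*} [LinearOrder α] (c : α → α → Bool × Bool) (m : ℕ)
    (S : Finset α) (hS : 4 ^ (4 * m + 1) ≤ #S) :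
    ∃ T ⊆ S, #T = m ∧ ∃ k, ∀ x ∈ T, ∀ y ∈ T, x < y → c x y = k := by
  obtain ⟨T, hTS, hc, hh⟩ := ramsey_pair c _ S hS
  have hne : T.Nonempty := by rw [← card_pos]; omega
  set w := T.max' hne
  have hw : w ∈ T := T.max'_mem hne
  rcases Nat.eq_zero_or_pos m with rfl | hm
  · exact ⟨∅, by simp, by simp, (true, true), by simp⟩
  obtain ⟨k, -, hk⟩ := exists_lt_card_fiber_of_mul_lt_card_of_maps_to
      (s := T) (t := (univ : Finset (Bool × Bool))) (f := fun z => c z w) (n := m - 1)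
      (by simp) (by
        simp only [card_univ, Fintype.card_prod, Fintype.card_bool]
        omega)
  obtain ⟨U, hU, hUc⟩ := exists_subset_card_eq (Nat.le_of_pred_lt hk)
  have hU' : ∀ z ∈ U, z ∈ T ∧ c z w = k := fun z hz => by
    simpa using hU hz
  refine ⟨U, fun z hz => hTS (hU' z hz).1, hUc, k, fun x hx y hy hxy => ?_⟩
  rw [← (hU' x hx).2]
  exact hh x (hU' x hx).1 y (hU' y hy).1 w hw hxy (lt_of_lt_of_le hxy (T.le_max' y (hU' y hy).1))

open Finset in
lemma ramsey_triple {α : Type*} [LinearOrder α] (f : α → α → α → Bool × Bool) :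
    ∀ (t : ℕ) (L S : Finset α), (∀ x ∈ L, ∀ y ∈ S, x < y) →
      (∀ x ∈ L, ∀ y ∈ L, ∀ z ∈ S, ∀ w ∈ S, x < y → f x y z = f x y w) →
      4 ^ ((#L + t) * t) ≤ #S → ∃ T ⊆ S, #T = t ∧
      ∀ x ∈ L ∪ T, ∀ y ∈ L ∪ T, ∀ z ∈ T, ∀ w ∈ T, x < y → y < z → y < w →
        f x y z = f x y w := by
  intro t
  induction t with
  | zero => intro L S _ _ _; exact ⟨∅, by simp, by simp, by simp⟩
  | succ t ih =>
    intro L S hLS hL hS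
    have hne : S.Nonempty := by
      rw [← card_pos]; exact lt_of_lt_of_le (by positivity) hS
    set x := S.min' hne with hx
    have hxS : x ∈ S := S.min'_mem hne
    have hxL : x ∉ L := fun h => lt_irrefl _ (hLS x h x hxS)
    set B := 4 ^ ((#L + 1 + t) * t) with hB
    have hpos : 0 < B := by positivity
    obtain ⟨y, -, hy⟩ := exists_lt_card_fiber_of_mul_lt_card_of_maps_to
      (s := S.erase x) (t := (univ : Finset (L → Bool × Bool)))
      (f := fun z => fun a : L => f a x z) (n := B - 1)
      (by simp) (by
        rw [card_erase_of_mem hxS]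
        have hcard : #(univ : Finset (L → Bool × Bool)) = 4 ^ (#L) := by simp
        rw [hcard]
        have h3 : 4 ^ (#L) * (B - 1) + 4 ^ (#L) = 4 ^ (#L) * B := by
          rw [← Nat.mul_succ]; congr 1; omega
        have h4 : 4 * (4 ^ (#L) * B) ≤ #S := by
          refine le_trans ?_ hS
          rw [hB, ← pow_add, ← pow_succ']
          apply Nat.pow_le_pow_right (by norm_num)
          nlinarith
        have h5 : 0 < 4 ^ (#L) := by positivity
        generalize 4 ^ (#L) * (B - 1) = X at *
        generalize 4 ^ (#L) * B = Y at *
        generalize 4 ^ (#L) = Z at *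
        omega)
    have hfil : ∀ z ∈ (S.erase x).filter (fun z => (fun a : L => f a x z) = y),
        z ∈ S ∧ x < z ∧ ∀ a (ha : a ∈ L), f a x z = y ⟨a, ha⟩ := by
      intro z hz
      simp only [mem_filter, mem_erase] at hz
      refine ⟨hz.1.2, lt_of_le_of_ne (S.min'_le z hz.1.2) (Ne.symm hz.1.1), ?_⟩
      intro a ha
      exact congrFun hz.2 ⟨a, ha⟩
    obtain ⟨T, hT, hc, hh⟩ := ih (insert x L) _ (by
      intro a ha b hb
      rcases mem_insert.1 ha with rfl | ha
      · exact (hfil b hb).2.1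
      · exact hLS a ha b (hfil b hb).1) (by
      intro a ha b hb z hz w hw hab
      rcases mem_insert.1 hb with hb | hb
      · subst hb
        have ha' := (mem_insert.1 ha).resolve_left hab.ne
        rw [(hfil z hz).2.2 a ha', (hfil w hw).2.2 a ha']
      · have hbx := hLS b hb x hxS
        have ha' := (mem_insert.1 ha).resolve_left (hab.trans hbx).ne
        exact hL a ha' b hb z (hfil z hz).1 w (hfil w hw).1 hab) (by
      rw [card_insert_of_notMem hxL]
      exact Nat.le_of_pred_lt hy)
    have hT' := fun z (hz : z ∈ T) => hfil z (hT hz)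
    have hxT : x ∉ T := fun h => lt_irrefl _ (hT' x h).2.1
    have hLx : ∀ a ∈ L ∪ insert x T, a < x → a ∈ L := by
      intro a ha hax
      rcases mem_union.1 ha with h | h
      · exact h
      · rcases mem_insert.1 h with h | h
        · exact absurd h hax.ne
        · exact absurd (hT' a h).2.1 hax.not_gt
    have hTS : insert x T ⊆ S := by
      intro z hz
      rcases mem_insert.1 hz with rfl | h
      · exact hxS
      · exact (hT' z h).1
    have hun : L ∪ insert x T = insert x L ∪ T := by
      ext; simp only [mem_union, mem_insert]; tauto
    refine ⟨insert x T, hTS, by rw [card_insert_of_notMem hxT, hc], ?_⟩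
    intro a ha b hb z hz w hw hab hbz hbw
    by_cases hbx : b < x
    · have hb' := hLx b hb hbx
      have ha' := hLx a ha (hab.trans hbx)
      exact hL a ha' b hb' z (hTS hz) w (hTS hw) hab
    · push Not at hbx
      have hz' := (mem_insert.1 hz).resolve_left (lt_of_le_of_lt hbx hbz).ne'
      have hw' := (mem_insert.1 hw).resolve_left (lt_of_le_of_lt hbx hbw).ne'
      rw [hun] at ha hb
      exact hh a ha b hb z hz' w hw' hab hbz hbw

/-- Number of points needed. -/
def need (m : ℕ) : ℕ := 4 ^ ((4 ^ (4 * m + 1) + 1) * (4 ^ (4 * m + 1) + 1))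

open Finset in
lemma ramsey_final {α : Type*} [LinearOrder α] (f : α → α → α → Bool × Bool) (m : ℕ)
    (S : Finset α) (hS : need m ≤ #S) :
    ∃ T ⊆ S, #T = m ∧ ∃ k, ∀ x ∈ T, ∀ y ∈ T, ∀ z ∈ T, x < y → y < z → f x y z = k := by
  obtain ⟨T, hTS, hc, hh⟩ := ramsey_triple f (4 ^ (4 * m + 1) + 1) ∅ S (by simp) (by simp)
    (by simpa [need] using hS)
  have hne : T.Nonempty := by rw [← card_pos]; omega
  set w := T.max' hne
  have hw : w ∈ T := T.max'_mem hne
  obtain ⟨U, hU, hUc, k, hk⟩ := ramsey_pair' (fun x y => f x y w) m (T.erase w)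
    (by rw [card_erase_of_mem hw]; omega)
  have hU' : ∀ z ∈ U, z ∈ T := fun z hz => mem_of_mem_erase (hU hz)
  refine ⟨U, fun z hz => hTS (hU' z hz), hUc, k, fun x hx y hy z hz hxy hyz => ?_⟩
  rw [← hk x hx y hy hxy]
  have := T.le_max' z (hU' z hz)
  exact hh x (by simpa using hU' x hx) y (by simpa using hU' y hy) z (hU' z hz) w hw hxy hyz
    (lt_of_lt_of_le hyz this)

/-! ### The tree -/

lemma tree_of_seq (P : Finset Pt) (φ : Pt → Pt → ℝ) (H : ℕ) (q : ℕ → Pt) (ε : ℝ)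
    (hP : ∀ i < 2 ^ (H + 1) * (H + 1), q i ∈ P)
    (hinj : ∀ i < 2 ^ (H + 1) * (H + 1), ∀ j < 2 ^ (H + 1) * (H + 1), q i = q j → i = j)
    (hq : ∀ i j k, i < j → j < k → k < 2 ^ (H + 1) * (H + 1) → 0 < ε * det (q i) (q j) (q k))
    (hmono : (∀ i j k, i < j → j < k → k < 2 ^ (H + 1) * (H + 1) →
        φ (q i) (q j) < φ (q j) (q k)) ∨
      (∀ i j k, i < j → j < k → k < 2 ^ (H + 1) * (H + 1) → φ (q j) (q k) < φ (q i) (q j))) :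
    ∃ t : ℕ → Pt, TreeEmbed P H t ∧ TreeNonCross H t ∧ TreeMonotone φ H t := by
  refine ⟨fun j => q (pos H j), ⟨fun i hi => hP _ (pos_lt hi), ?_⟩, ?_, ?_⟩
  · intro i hi j hj h
    exact pos_inj (dep_le hi) (dep_le hj) (hinj _ (pos_lt hi) _ (pos_lt hj) h)
  · intro i hi1 hi j hj1 hj hij
    refine seq_noCross hq (pos_lt hi) (pos_lt hj) (pos_par_lt hi1 (dep_le hi))
      (pos_par_lt hj1 (dep_le hj)) (fun h => hij (pos_inj (dep_le hi) (dep_le hj) h))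
      (pos_noninter hi1 hj1 (dep_le hi) (dep_le hj)) (pos_noninter hj1 hi1 (dep_le hj) (dep_le hi))
  · have key : ∀ j, 3 ≤ j → j < treeSize H → pos H (par (par j)) < pos H (par j) ∧
        pos H (par j) < pos H j := fun j hj hjH =>
      ⟨pos_par_lt (by unfold par; omega) (dep_le (par_lt hjH)),
        pos_par_lt (by omega) (dep_le hjH)⟩
    rcases hmono with h | h
    · left
      intro j hj hjH
      exact h _ _ _ (key j hj hjH).1 (key j hj hjH).2 (pos_lt hjH)
    · right
      intro j hj hjH
      exact h _ _ _ (key j hj hjH).1 (key j hj hjH).2 (pos_lt hjH)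

lemma exists_tree (P : Finset Pt) (hG : GeneralPosition ↑P) (φ : Pt → Pt → ℝ)
    (hφ : EdgeOrderOn P φ) (H : ℕ) (hn : need (2 ^ (H + 1) * (H + 1)) ≤ P.card) :
    ∃ t : ℕ → Pt, TreeEmbed P H t ∧ TreeNonCross H t ∧ TreeMonotone φ H t := by
  classical
  generalize hm : 2 ^ (H + 1) * (H + 1) = m at hn
  let e := P.equivFin.symm
  let p : Fin P.card → Pt := fun i => (e i : Pt)
  have hpP : ∀ i, p i ∈ P := fun i => (e i).2
  have hpinj : Function.Injective p := fun i j h => e.injective (Subtype.ext h)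
  obtain ⟨T, -, hT, ⟨k1, k2⟩, hk⟩ := ramsey_final
    (fun i j k : Fin P.card => (decide (0 < det (p i) (p j) (p k)),
      decide (φ (p i) (p j) < φ (p j) (p k)))) m Finset.univ (by simpa using hn)
  simp only [Prod.mk.injEq] at hk
  let r : Fin m ↪o Fin P.card := T.orderEmbOfFin hT
  have hr : ∀ i, r i ∈ T := fun i => T.orderEmbOfFin_mem hT i
  let q : ℕ → Pt := fun i => if h : i < m then p (r ⟨i, h⟩) else 0
  have hq : ∀ i (h : i < m), q i = p (r ⟨i, h⟩) := fun i h => by simp [q, h]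
  have hinj : ∀ i < m, ∀ j < m, q i = q j → i = j := by
    intro i hi j hj h
    rw [hq i hi, hq j hj] at h
    have := r.injective (hpinj h)
    simpa using this
  have hqP : ∀ i < m, q i ∈ P := fun i hi => by rw [hq i hi]; exact hpP _
  have hkk : ∀ i j k, i < j → j < k → k < m →
      decide (0 < det (q i) (q j) (q k)) = k1 ∧
      decide (φ (q i) (q j) < φ (q j) (q k)) = k2 := by
    intro i j k hij hjk hkm
    rw [hq i (by omega), hq j (by omega), hq k hkm]
    exact hk _ (hr _) _ (hr _) _ (hr _) (r.strictMono hij) (r.strictMono hjk)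
  have hdet : ∃ ε : ℝ, ∀ i j k, i < j → j < k → k < m → 0 < ε * det (q i) (q j) (q k) := by
    cases k1 with
    | true => exact ⟨1, fun i j k h1 h2 h3 => by simpa using (hkk i j k h1 h2 h3).1⟩
    | false =>
      refine ⟨-1, fun i j k h1 h2 h3 => ?_⟩
      have h4 := (hkk i j k h1 h2 h3).1
      simp only [decide_eq_false_iff_not, not_lt] at h4
      have hij : q i ≠ q j := fun h => by
        have := hinj i (by omega) j (by omega) h
        omega
      have hjk : q j ≠ q k := fun h => by
        have := hinj j (by omega) k (by omega) h
        omega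
      have hik : q i ≠ q k := fun h => by
        have := hinj i (by omega) k (by omega) h
        omega
      have h5 := det_ne hij (hG _ (hqP i (by omega)) _ (hqP j (by omega)) _ (hqP k h3) hij hjk hik)
      have := lt_of_le_of_ne h4 h5
      linarith
  obtain ⟨ε, hε⟩ := hdet
  refine tree_of_seq P φ H q ε (by rwa [hm]) (by rwa [hm]) (by rwa [hm]) ?_
  rw [hm]
  cases k2 with
  | true =>
    left
    exact fun i j k h1 h2 h3 => by simpa using (hkk i j k h1 h2 h3).2
  | false =>
    right
    intro i j k h1 h2 h3
    have h4 := (hkk i j k h1 h2 h3).2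
    simp only [decide_eq_false_iff_not, not_lt] at h4
    refine lt_of_le_of_ne h4 fun h => ?_
    have hij : q i ≠ q j := fun h => by
      have := hinj i (by omega) j (by omega) h
      omega
    have hjk : q j ≠ q k := fun h => by
      have := hinj j (by omega) k (by omega) h
      omega
    have hik : q i ≠ q k := fun h => by
      have := hinj i (by omega) k (by omega) h
      omega
    have h5 := hφ.2 _ (hqP j (by omega)) _ (hqP k h3) _ (hqP i (by omega)) _ (hqP j (by omega))
      hjk hij h
    have h6 : q k ∈ ({q i, q j} : Set Pt) := by rw [← h5]; simp
    rcases h6 with h6 | h6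
    · exact hik h6.symm
    · exact hjk h6.symm

/-! ### Numerics -/

lemma need_le (H : ℕ) : (need (2 ^ (H + 2) * (H + 2)) : ℝ) ≤
    Real.exp (Real.exp (Real.exp (2 * H + 9))) := by
  have h4 : ∀ k : ℕ, ((4 : ℝ) ^ k) ≤ Real.exp (2 * k) := by
    intro k
    have h1 : (4 : ℝ) ≤ Real.exp 2 := by
      have : Real.exp 2 = Real.exp 1 * Real.exp 1 := by rw [← Real.exp_add]; norm_num
      rw [this]
      nlinarith [Real.add_one_le_exp (1 : ℝ)]
    calc (4 : ℝ) ^ k ≤ (Real.exp 2) ^ k := by gcongr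
      _ = Real.exp (2 * k) := by rw [← Real.exp_nat_mul]; ring_nf
  have h2 : ∀ k : ℕ, ((2 : ℝ) ^ k) ≤ Real.exp k := by
    intro k
    calc (2 : ℝ) ^ k ≤ (Real.exp 1) ^ k := by
          gcongr; nlinarith [Real.add_one_le_exp (1 : ℝ)]
      _ = Real.exp k := by rw [← Real.exp_nat_mul]; ring_nf
  set m := 2 ^ (H + 2) * (H + 2) with hm
  have hmle : 16 * m + 10 ≤ 2 ^ (2 * H + 9) := by
    have h1 : H + 2 < 2 ^ (H + 2) := Nat.lt_two_pow_self
    have h3 : m ≤ 2 ^ (H + 2) * 2 ^ (H + 2) := Nat.mul_le_mul_left _ h1.le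
    have h6 : 0 < 2 ^ (H + 2) * 2 ^ (H + 2) := by positivity
    have h5 : 2 ^ (2 * H + 9) = 32 * (2 ^ (H + 2) * 2 ^ (H + 2)) := by ring
    omega
  have hE : (4 ^ (4 * m + 1) + 1) * (4 ^ (4 * m + 1) + 1) * 2 ≤ 4 ^ (8 * m + 5) := by
    have h1 : 1 ≤ 4 ^ (4 * m + 1) := Nat.one_le_pow _ _ (by norm_num)
    have h3 : 4 ^ (8 * m + 5) = 64 * (4 ^ (4 * m + 1) * 4 ^ (4 * m + 1)) := by ring
    rw [h3]
    nlinarith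
  have hE' : (2 : ℝ) * (((4 ^ (4 * m + 1) + 1) * (4 ^ (4 * m + 1) + 1) : ℕ) : ℝ) ≤
      (4 : ℝ) ^ (8 * m + 5) := by
    have : (((4 ^ (4 * m + 1) + 1) * (4 ^ (4 * m + 1) + 1) * 2 : ℕ) : ℝ) ≤
      ((4 ^ (8 * m + 5) : ℕ) : ℝ) := by exact_mod_cast hE
    rw [Nat.cast_mul _ 2, Nat.cast_pow] at this
    push_cast at this ⊢
    linarith
  unfold need
  rw [Nat.cast_pow]
  refine (h4 _).trans (Real.exp_le_exp.2 (hE'.trans ((h4 _).trans (Real.exp_le_exp.2 ?_))))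
  have h6 : ((16 * m + 10 : ℕ) : ℝ) ≤ ((2 ^ (2 * H + 9) : ℕ) : ℝ) := by exact_mod_cast hmle
  have h7 := h2 (2 * H + 9)
  push_cast at h6 h7 ⊢
  linarith

lemma le_need (m : ℕ) : m ≤ need m := by
  unfold need
  have h1 : 4 * m + 1 < 4 ^ (4 * m + 1) := Nat.lt_pow_self (by norm_num)
  have h2 : ∀ k, k < 4 ^ k := fun k => Nat.lt_pow_self (by norm_num)
  refine le_trans ?_ (h2 _).le
  nlinarith

lemma exists_H (n : ℕ) (h0 : need (2 ^ (0 + 1) * (0 + 1)) ≤ n) :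
    ∃ H, need (2 ^ (H + 1) * (H + 1)) ≤ n ∧ n < need (2 ^ (H + 2) * (H + 2)) := by
  have hex : ∃ H, n < need (2 ^ (H + 1) * (H + 1)) := by
    refine ⟨n, lt_of_lt_of_le ?_ (le_need _)⟩
    have : 1 ≤ 2 ^ (n + 1) := Nat.one_le_two_pow
    nlinarith
  classical
  have hs := Nat.find_spec hex
  have hne : Nat.find hex ≠ 0 := fun h => by
    rw [h] at hs
    omega
  obtain ⟨H, hH⟩ := Nat.exists_eq_succ_of_ne_zero hne
  refine ⟨H, ?_, ?_⟩
  · have := Nat.find_min hex (m := H) (by omega)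
    omega
  · rw [hH] at hs
    exact hs

end MT

/-- `τ̄(Kₙ) = Ω(log log log n)`: there is `c > 0` such that for every
sufficiently large `n`, every edge-ordering of the complete geometric graph on any
`n` points in general position admits a non-crossing monotone embedded complete
binary tree of size at least `c·log log log n`. -/
theorem stmt6 : ∃ c : ℝ, 0 < c ∧ ∃ N : ℕ,
    ∀ n : ℕ, N ≤ n → ∀ P : Finset Pt, P.card = n → GeneralPosition ↑P →
      ∀ φ : Pt → Pt → ℝ, EdgeOrderOn P φ →
        ∃ (h : ℕ) (t : ℕ → Pt),
          TreeEmbed P h t ∧ TreeNonCross h t ∧ TreeMonotone φ h t ∧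
          c * Real.log (Real.log (Real.log n)) ≤ (treeSize h : ℝ) := by
  refine ⟨1 / 9, by norm_num, max 3 (MT.need (2 ^ (0 + 1) * (0 + 1))), ?_⟩
  intro n hn P hP hG φ hφ
  obtain ⟨H, h1, h2⟩ := MT.exists_H n (le_trans (le_max_right _ _) hn)
  obtain ⟨t, ht1, ht2, ht3⟩ := MT.exists_tree P hG φ hφ H (by rw [hP]; exact h1)
  refine ⟨H, t, ht1, ht2, ht3, ?_⟩
  have hn3 : (3 : ℝ) ≤ n := by exact_mod_cast le_trans (le_max_left _ _) hn
  have hl1 : 1 < Real.log n := by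
    rw [Real.lt_log_iff_exp_lt (by linarith)]
    linarith [Real.exp_one_lt_d9]
  have hl2 : 0 < Real.log (Real.log n) := Real.log_pos hl1
  have hle : (n : ℝ) ≤ Real.exp (Real.exp (Real.exp (2 * H + 9))) :=
    le_trans (by exact_mod_cast h2.le) (MT.need_le H)
  have hlog : Real.log (Real.log (Real.log n)) ≤ 2 * H + 9 := by
    rw [Real.log_le_iff_le_exp hl2, Real.log_le_iff_le_exp (by linarith),
      Real.log_le_iff_le_exp (by linarith)]
    exact hle
  have hsz : 2 * H + 9 ≤ 9 * treeSize H := by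
    unfold treeSize
    have : H + 1 < 2 ^ (H + 1) := Nat.lt_two_pow_self
    omega
  have hsz' : (2 * H + 9 : ℝ) ≤ 9 * treeSize H := by exact_mod_cast hsz
  linarith
end
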